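/- arXiv:1306.1787 — 6 statements merged into one kernel-verified Lean document; each statement's English description precedes it below -/
import Mathlib

section
/- Let X be a set of variables with ordered partition π = (X_1,…,X_n), each X_i linearly ordered with order type at most ω, and bounds e_i = (e_{i,1}, e_{i,2}, …), e_{i,j} ∈ ℙ ∪ {∞}, satisfying e_{i,1} ≥ e_{i,2} ≥ ⋯ for every i ∈ [n]. Let (M,π) be a finite colored multicomplex of type a ∈ ℙ^n in M_π(e_1,…,e_n). Call (M', π) a color compression of (M, π) if (M', π) is color-compressed and M' = C_{t_k}(C_{t_{k−1}}(⋯ C_{t_1}(M)⋯)) for some finite sequence t_1,…,t_k of integers in [n] such that each application of C_{t_i} changes the multicomplex. Then (M,π) has at most n! color compressions. -/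
open Finset

/-- Monomials in the variables `x_{i,j}` (`i : Fin n` a color, `j : ℕ` a position
within the `i`-th linearly ordered block), as finitely supported exponent vectors. -/
abbrev MCMon (n : ℕ) : Type := (Fin n × ℕ) →₀ ℕ

/-- Total degree of a monomial. -/
def totalDeg {n : ℕ} (m : MCMon n) : ℕ := ∑ v ∈ m.support, m v

/-- Degree of the restriction of `m` to the variables of color `t`. -/
def degOn {n : ℕ} (t : Fin n) (m : MCMon n) : ℕ :=
  ∑ v ∈ m.support, if v.1 = t then m v else 0

/-- `M` is a multicomplex: a nonempty set of monomials closed under divisibility. -/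
def IsMulticomplex {n : ℕ} (M : Set (MCMon n)) : Prop :=
  M.Nonempty ∧ ∀ m ∈ M, ∀ m' : MCMon n, (∀ v, m' v ≤ m v) → m' ∈ M

/-- `m` is a member of `𝓜_π(e₁,…,eₙ)`: each variable `x_{i,j}` occurring in `m`
exists (i.e. `j ∈ S i`) and the exponents respect the bounds `e`. -/
def InBounds {n : ℕ} (S : Fin n → Set ℕ) (e : Fin n → ℕ → ℕ∞) (m : MCMon n) : Prop :=
  ∀ (i : Fin n) (j : ℕ), m (i, j) ≠ 0 → j ∈ S i ∧ (m (i, j) : ℕ∞) ≤ e i j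

/-- `(M, π)` is a colored multicomplex of type `a`. -/
def IsColoredType {n : ℕ} (a : Fin n → ℕ) (M : Set (MCMon n)) : Prop :=
  ∀ m ∈ M, ∀ i, degOn i m ≤ a i

/-- `m` and `p` have the same restriction to the variables of colors other than `t`. -/
def agreeAway {n : ℕ} (t : Fin n) (m p : MCMon n) : Prop :=
  ∀ v : Fin n × ℕ, v.1 ≠ t → m v = p v

/-- `𝓜^d_{X_t}(e_t)`: the monomials of degree `d` in the variables of color `t`,
within the bounds `e`. -/
def ColorMon {n : ℕ} (S : Fin n → Set ℕ) (e : Fin n → ℕ → ℕ∞) (t : Fin n) (d : ℕ) :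
    Set (MCMon n) :=
  {q | (∀ v ∈ q.support, v.1 = t) ∧ InBounds S e q ∧ totalDeg q = d}

/-- The color-`t` part of `q` is lexicographically at most the color-`t` part of
`p`: either they are equal, or `q` is strictly smaller at the largest position
where they differ. -/
def lexLePart {n : ℕ} (t : Fin n) (q p : MCMon n) : Prop :=
  (∀ j : ℕ, q (t, j) = p (t, j)) ∨
    ∃ j : ℕ, q (t, j) < p (t, j) ∧ ∀ k : ℕ, j < k → q (t, k) = p (t, k)

/-- The color-`t` part of `p` is a legitimate monomial in the variables of color
`t`, within bounds. -/
def colorPartOk {n : ℕ} (S : Fin n → Set ℕ) (e : Fin n → ℕ → ℕ∞) (t : Fin n)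
    (p : MCMon n) : Prop :=
  ∀ j : ℕ, p (t, j) ≠ 0 → j ∈ S t ∧ (p (t, j) : ℕ∞) ≤ e t j

/-- The color compression operation `C_t`: `p ∈ C_t(M)` iff the restriction of `p`
away from color `t` is the restriction `m̃` of some member of `M`, and the color-`t`
part of `p` lies in the lexicographic initial segment `I^{d;e_t}_{X_t}(f_d(m̃))` of
`𝓜^d_{X_t}(e_t)` (where `d = degOn t p`); membership in this initial segment is
expressed by saying that the number of monomials of `𝓜^d_{X_t}(e_t)` which are
lexicographically at most the color-`t` part of `p` is at most
`f_d(m̃) = #{m ∈ M : m agrees with p away from t, degOn t m = d}`. -/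
noncomputable def compressOp {n : ℕ} (S : Fin n → Set ℕ) (e : Fin n → ℕ → ℕ∞)
    (M : Set (MCMon n)) (t : Fin n) : Set (MCMon n) :=
  {p | (∃ m ∈ M, agreeAway t m p) ∧ colorPartOk S e t p ∧
    {q | q ∈ ColorMon S e t (degOn t p) ∧ lexLePart t q p}.ncard ≤
      {m | m ∈ M ∧ agreeAway t m p ∧ degOn t m = degOn t p}.ncard}

/-- `M'` is a color compression of `M`: it is color-compressed
(i.e. `C_t(M') = M'` for all `t`) and is obtained from `M` by finitely many
applications of the operations `C_t`, each of which changes the multicomplex. -/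
def IsColorCompressionOf {n : ℕ} (S : Fin n → Set ℕ) (e : Fin n → ℕ → ℕ∞)
    (M M' : Set (MCMon n)) : Prop :=
  (∀ t, compressOp S e M' t = M') ∧
    ∃ (k : ℕ) (ts : Fin k → Fin n) (Ms : Fin (k + 1) → Set (MCMon n)),
      Ms 0 = M ∧ Ms (Fin.last k) = M' ∧
      ∀ i : Fin k, Ms i.succ = compressOp S e (Ms i.castSucc) (ts i) ∧
        Ms i.succ ≠ Ms i.castSucc

namespace ColorCompression

variable {n : ℕ} {S : Fin n → Set ℕ} {e : Fin n → ℕ → ℕ∞} {s t : Fin n}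

/-- The monomial with the color-`t` part of `p` and the remaining part of `m`. -/
noncomputable def replacePart (t : Fin n) (m p : MCMon n) : MCMon n :=
  p.filter (fun v => v.1 = t) + m.filter (fun v => v.1 ≠ t)

lemma replacePart_apply_of_eq (m p : MCMon n) {v : Fin n × ℕ} (h : v.1 = t) :
    replacePart t m p v = p v := by
  simp [replacePart, h]

lemma replacePart_apply_of_ne (m p : MCMon n) {v : Fin n × ℕ} (h : v.1 ≠ t) :
    replacePart t m p v = m v := by
  simp [replacePart, h]

lemma degOn_congr {m p : MCMon n} (h : ∀ j, m (t, j) = p (t, j)) :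
    degOn t m = degOn t p := by
  have key : ∀ q : MCMon n,
      degOn t q = (q.filter (fun v => v.1 = t)).sum fun _ x => x := by
    intro q
    rw [degOn, Finsupp.sum, Finsupp.support_filter, Finset.sum_filter]
    refine Finset.sum_congr rfl fun v _ => ?_
    by_cases hv : v.1 = t <;> simp [hv]
  rw [key, key]
  congr 1
  ext ⟨i, j⟩
  by_cases hi : i = t
  · subst hi
    simp [h]
  · simp [hi]

lemma totalDeg_eq_degOn {q : MCMon n} (h : ∀ v ∈ q.support, v.1 = t) :
    totalDeg q = degOn t q :=
  Finset.sum_congr rfl fun v hv => by simp [h v hv]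

lemma apply_le_degOn (m : MCMon n) (j : ℕ) : m (t, j) ≤ degOn t m := by
  by_cases h : m (t, j) = 0
  · simp [h]
  · have := Finset.single_le_sum (f := fun v : Fin n × ℕ => if v.1 = t then m v else 0)
      (fun _ _ => Nat.zero_le _) (Finsupp.mem_support_iff.2 h)
    simpa [degOn] using this

lemma lexLePart_refl (p : MCMon n) : lexLePart t p p := Or.inl fun _ => rfl

lemma lexLePart_trans {p q r : MCMon n} (hpq : lexLePart t p q) (hqr : lexLePart t q r) :
    lexLePart t p r := by
  rcases hpq with hpq | ⟨j, hj, hj'⟩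
  · rcases hqr with hqr | ⟨k, hk, hk'⟩
    · exact Or.inl fun i => (hpq i).trans (hqr i)
    · exact Or.inr ⟨k, by rwa [hpq], fun i hi => (hpq i).trans (hk' i hi)⟩
  · rcases hqr with hqr | ⟨k, hk, hk'⟩
    · exact Or.inr ⟨j, by rwa [← hqr], fun i hi => (hj' i hi).trans (hqr i)⟩
    · refine Or.inr ⟨max j k, ?_, fun i hi => ?_⟩
      · rcases lt_trichotomy j k with h | h | h
        · rw [max_eq_right h.le, hj' k h]
          exact hk
        · subst h
          simpa using hj.trans hk
        · rw [max_eq_left h.le, ← hk' j h]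
          exact hj
      · exact (hj' i (lt_of_le_of_lt (le_max_left _ _) hi)).trans
          (hk' i (lt_of_le_of_lt (le_max_right _ _) hi))

lemma lexLePart_total (t : Fin n) (p q : MCMon n) : lexLePart t p q ∨ lexLePart t q p := by
  classical
  let D := ((p.support ∪ q.support).image Prod.snd).filter fun j => p (t, j) ≠ q (t, j)
  have hD : ∀ j, p (t, j) ≠ q (t, j) → j ∈ D := by
    intro j hj
    refine Finset.mem_filter.2 ⟨Finset.mem_image.2 ⟨(t, j), ?_, rfl⟩, hj⟩
    by_contra h
    simp only [Finset.mem_union, Finsupp.mem_support_iff, not_or, not_not] at h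
    exact hj (h.1.trans h.2.symm)
  rcases D.eq_empty_or_nonempty with h | h
  · refine Or.inl (Or.inl fun j => ?_)
    by_contra hj
    simpa [h] using hD j hj
  · have hne : p (t, D.max' h) ≠ q (t, D.max' h) := (Finset.mem_filter.1 (D.max'_mem h)).2
    have heq : ∀ k, D.max' h < k → p (t, k) = q (t, k) := by
      intro k hk
      by_contra hne
      exact absurd (D.le_max' k (hD k hne)) (not_le.2 hk)
    rcases hne.lt_or_gt with hlt | hlt
    · exact Or.inl (Or.inr ⟨_, hlt, heq⟩)
    · exact Or.inr (Or.inr ⟨_, hlt, fun k hk => (heq k hk).symm⟩)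

lemma lexLePart_congr {p p' q q' : MCMon n} (hp : ∀ j, p (t, j) = p' (t, j))
    (hq : ∀ j, q (t, j) = q' (t, j)) : lexLePart t p q ↔ lexLePart t p' q' := by
  simp only [lexLePart, hp, hq]

lemma finite_lexLePart_fiber (t : Fin n) (m : MCMon n) :
    {p | agreeAway t p m ∧ degOn t p = degOn t m ∧ lexLePart t p m}.Finite := by
  classical
  obtain ⟨J, hJ⟩ : ∃ J, ∀ j, J ≤ j → m (t, j) = 0 := by
    obtain ⟨B, hB⟩ := (m.support.image Prod.snd).bddAbove
    refine ⟨B + 1, fun j hj => ?_⟩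
    by_contra h
    have := hB (Finset.mem_coe.2 (Finset.mem_image.2 ⟨(t, j), Finsupp.mem_support_iff.2 h, rfl⟩))
    simp only at this
    omega
  refine (Set.finite_Iic
    (m + ∑ j ∈ Finset.range J, Finsupp.single (t, j) (degOn t m))).subset ?_
  rintro p ⟨hag, hdeg, hlex⟩ ⟨i, j⟩
  by_cases hi : i = t
  · subst hi
    by_cases hj : j < J
    · refine (apply_le_degOn p j).trans ?_
      rw [hdeg, Finsupp.add_apply, Finsupp.finsetSum_apply]
      refine le_trans ?_ (Nat.le_add_left _ _)
      refine le_trans ?_ (Finset.single_le_sum (fun _ _ => Nat.zero_le _)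
        (Finset.mem_range.2 hj))
      simp
    · have : p (i, j) = 0 := by
        rcases hlex with h | ⟨k, hk, hk'⟩
        · rw [h, hJ j (not_lt.1 hj)]
        · have hkJ : k < J := by
            by_contra hc
            rw [hJ k (not_lt.1 hc)] at hk
            exact absurd hk (Nat.not_lt_zero _)
          rw [hk' j (by omega), hJ j (not_lt.1 hj)]
      simp [this]
  · rw [hag (i, j) hi]
    simp

lemma mem_colorMon_iff {d : ℕ} {q : MCMon n} :
    q ∈ ColorMon S e t d ↔
      (∀ v, v.1 ≠ t → q v = 0) ∧ colorPartOk S e t q ∧ degOn t q = d := by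
  constructor
  · rintro ⟨h1, h2, h3⟩
    exact ⟨fun v hv => by_contra fun h => hv (h1 v (Finsupp.mem_support_iff.2 h)),
      h2 t, (totalDeg_eq_degOn h1).symm.trans h3⟩
  · rintro ⟨h1, h2, h3⟩
    have h1' : ∀ v ∈ q.support, v.1 = t := fun v hv =>
      by_contra fun h => Finsupp.mem_support_iff.1 hv (h1 v h)
    refine ⟨h1', fun i j hij => ?_, (totalDeg_eq_degOn h1').trans h3⟩
    obtain rfl : i = t := h1' (i, j) (Finsupp.mem_support_iff.2 hij)
    exact h2 j hij

lemma finite_colorMon_lexLePart (S : Fin n → Set ℕ) (e : Fin n → ℕ → ℕ∞) (t : Fin n)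
    (p : MCMon n) : {q | q ∈ ColorMon S e t (degOn t p) ∧ lexLePart t q p}.Finite := by
  have hpart : ∀ j, replacePart t 0 p (t, j) = p (t, j) := fun j =>
    replacePart_apply_of_eq 0 p rfl
  refine (finite_lexLePart_fiber t (replacePart t 0 p)).subset ?_
  rintro q ⟨hq, hlex⟩
  obtain ⟨h0, -, hdeg⟩ := mem_colorMon_iff.1 hq
  refine ⟨fun v hv => ?_, hdeg.trans (degOn_congr hpart).symm,
    (lexLePart_congr (fun _ => rfl) hpart).2 hlex⟩
  rw [h0 v hv, replacePart_apply_of_ne _ _ hv, Finsupp.zero_apply]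

/-- Every fiber of `M` in the color `t` is, in each degree, a lexicographic initial segment. -/
def IsInitial (S : Fin n → Set ℕ) (e : Fin n → ℕ → ℕ∞) (t : Fin n) (M : Set (MCMon n)) : Prop :=
  ∀ p ∈ M, ∀ q, agreeAway t q p → degOn t q = degOn t p → colorPartOk S e t q →
    lexLePart t q p → q ∈ M

lemma agreeAway_comm {m p : MCMon n} (h : agreeAway t m p) : agreeAway t p m :=
  fun v hv => (h v hv).symm

lemma agreeAway_trans {m p q : MCMon n} (h : agreeAway t m p) (h' : agreeAway t p q) :
    agreeAway t m q :=
  fun v hv => (h v hv).trans (h' v hv)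

lemma eq_of_agreeAway {m p : MCMon n} (h : agreeAway t m p)
    (h' : ∀ j, m (t, j) = p (t, j)) : m = p := by
  ext ⟨i, j⟩
  by_cases hi : i = t
  · subst hi
    exact h' j
  · exact h (i, j) hi

lemma replacePart_zero_mem_colorMon {m : MCMon n} (h : colorPartOk S e t m) :
    replacePart t 0 m ∈ ColorMon S e t (degOn t m) := by
  have hpart : ∀ j, replacePart t 0 m (t, j) = m (t, j) := fun j =>
    replacePart_apply_of_eq 0 m rfl
  refine mem_colorMon_iff.2 ⟨fun v hv => replacePart_apply_of_ne _ _ hv, fun j hj => ?_,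
    degOn_congr hpart⟩
  rw [hpart] at hj ⊢
  exact h j hj

lemma exists_lexLePart_of_mem_compressOp {M : Set (MCMon n)} (hfin : M.Finite)
    (hbd : ∀ m ∈ M, InBounds S e m) {p : MCMon n} (hp : p ∈ compressOp S e M t) :
    ∃ m ∈ M, agreeAway t m p ∧ degOn t m = degOn t p ∧ lexLePart t p m := by
  obtain ⟨-, hok, hcard⟩ := hp
  by_contra! hcon
  have hFfin : {m | m ∈ M ∧ agreeAway t m p ∧ degOn t m = degOn t p}.Finite :=
    hfin.subset fun m hm => hm.1
  have hpF : p ∉ {m | m ∈ M ∧ agreeAway t m p ∧ degOn t m = degOn t p} := fun h =>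
    hcon p h.1 h.2.1 h.2.2 (lexLePart_refl p)
  have hpart : ∀ m j, replacePart t 0 m (t, j) = m (t, j) := fun m j =>
    replacePart_apply_of_eq 0 m rfl
  have hag : ∀ m ∈ insert p {m | m ∈ M ∧ agreeAway t m p ∧ degOn t m = degOn t p},
      agreeAway t m p := by
    rintro m (rfl | hm)
    · exact fun _ _ => rfl
    · exact hm.2.1
  have hle := Set.ncard_le_ncard_of_injOn (replacePart t 0)
    (s := insert p {m | m ∈ M ∧ agreeAway t m p ∧ degOn t m = degOn t p})
    (t := {q | q ∈ ColorMon S e t (degOn t p) ∧ lexLePart t q p})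
    (by
      rintro m (rfl | ⟨hm, hma, hmd⟩)
      · exact ⟨replacePart_zero_mem_colorMon hok,
          (lexLePart_congr (hpart m) fun _ => rfl).2 (lexLePart_refl m)⟩
      · refine ⟨hmd ▸ replacePart_zero_mem_colorMon (hbd m hm t), ?_⟩
        exact (lexLePart_congr (hpart m) fun _ => rfl).2
          ((lexLePart_total t p m).resolve_left (hcon m hm hma hmd)))
    (by
      intro m hm m' hm' h
      refine eq_of_agreeAway (agreeAway_trans (hag m hm) (agreeAway_comm (hag m' hm')))
        fun j => ?_
      rw [← hpart m, h, hpart m'])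
    (finite_colorMon_lexLePart S e t p)
  rw [Set.ncard_insert_of_notMem hpF hFfin] at hle
  omega

lemma finite_compressOp {M : Set (MCMon n)} (hfin : M.Finite)
    (hbd : ∀ m ∈ M, InBounds S e m) (t : Fin n) : (compressOp S e M t).Finite := by
  refine (hfin.biUnion fun m _ => finite_lexLePart_fiber t m).subset fun p hp => ?_
  obtain ⟨m, hm, hag, hdeg, hlex⟩ := exists_lexLePart_of_mem_compressOp hfin hbd hp
  exact Set.mem_biUnion hm ⟨agreeAway_comm hag, hdeg.symm, hlex⟩

lemma inBounds_of_mem_compressOp {M : Set (MCMon n)} (hbd : ∀ m ∈ M, InBounds S e m) :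
    ∀ p ∈ compressOp S e M t, InBounds S e p := by
  rintro p ⟨⟨m, hm, hag⟩, hok, -⟩ i j hij
  by_cases hi : i = t
  · subst hi
    exact hok j hij
  · rw [← hag (i, j) hi] at hij ⊢
    exact hbd m hm i j hij

lemma isInitial_compressOp (M : Set (MCMon n)) : IsInitial S e t (compressOp S e M t) := by
  rintro p ⟨⟨m, hm, hag⟩, -, hcard⟩ q hqp hdeg hqok hlex
  refine ⟨⟨m, hm, agreeAway_trans hag (agreeAway_comm hqp)⟩, hqok, ?_⟩
  rw [hdeg]
  have hfib : {m | m ∈ M ∧ agreeAway t m q ∧ degOn t m = degOn t p} =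
      {m | m ∈ M ∧ agreeAway t m p ∧ degOn t m = degOn t p} := by
    ext m
    exact and_congr_right fun _ => and_congr_left fun _ =>
      ⟨fun h => agreeAway_trans h hqp, fun h => agreeAway_trans h (agreeAway_comm hqp)⟩
  rw [hfib]
  refine le_trans (Set.ncard_le_ncard ?_ (finite_colorMon_lexLePart S e t p)) hcard
  exact fun r hr => ⟨hr.1, lexLePart_trans hr.2 hlex⟩

lemma compressOp_eq_self {M : Set (MCMon n)} (hfin : M.Finite)
    (hbd : ∀ m ∈ M, InBounds S e m) (hinit : IsInitial S e t M) : compressOp S e M t = M := by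
  apply Set.Subset.antisymm
  · intro p hp
    obtain ⟨m, hm, hag, hdeg, hlex⟩ := exists_lexLePart_of_mem_compressOp hfin hbd hp
    exact hinit m hm p (agreeAway_comm hag) hdeg.symm hp.2.1 hlex
  · intro p hp
    refine ⟨⟨p, hp, fun _ _ => rfl⟩, hbd p hp t, ?_⟩
    have hpart : ∀ q j, replacePart t p q (t, j) = q (t, j) := fun q j =>
      replacePart_apply_of_eq p q rfl
    have hag : ∀ q, agreeAway t (replacePart t p q) p := fun q v hv =>
      replacePart_apply_of_ne p q hv
    refine Set.ncard_le_ncard_of_injOn (replacePart t p) ?_ ?_ (hfin.subset fun m hm => hm.1)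
    · rintro q ⟨hq, hlex⟩
      obtain ⟨-, hok, hdeg⟩ := mem_colorMon_iff.1 hq
      have hdeg' := (degOn_congr (hpart q)).trans hdeg
      refine ⟨hinit p hp _ (hag q) hdeg' (fun j hj => ?_)
        ((lexLePart_congr (hpart q) fun _ => rfl).2 hlex), hag q, hdeg'⟩
      rw [hpart] at hj ⊢
      exact hok j hj
    · rintro q ⟨hq, -⟩ q' ⟨hq', -⟩ h
      refine eq_of_agreeAway (t := t) (fun v hv => ?_) fun j => ?_
      · rw [(mem_colorMon_iff.1 hq).1 v hv, (mem_colorMon_iff.1 hq').1 v hv]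
      · rw [← hpart q, h, hpart q']

lemma IsInitial.compressOp {M : Set (MCMon n)} (hfin : M.Finite) (hst : s ≠ t)
    (hinit : IsInitial S e s M) : IsInitial S e s (compressOp S e M t) := by
  intro p hp p' hag hdeg hok hlex
  have ht : ∀ j, p' (t, j) = p (t, j) := fun j => hag (t, j) hst.symm
  have hs : ∀ m j, replacePart s m p' (s, j) = p' (s, j) := fun m j =>
    replacePart_apply_of_eq m p' rfl
  have hmem : ∀ m ∈ M, agreeAway t m p → replacePart s m p' ∈ M := by
    intro m hm hmp
    have hmp' : ∀ j, p (s, j) = m (s, j) := fun j => (hmp (s, j) hst).symm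
    refine hinit m hm _ (fun v hv => replacePart_apply_of_ne m p' hv) ?_ (fun j hj => ?_) ?_
    · exact (degOn_congr (hs m)).trans (hdeg.trans (degOn_congr hmp'))
    · rw [hs] at hj ⊢
      exact hok j hj
    · exact (lexLePart_congr (fun j => (hs m j).symm) hmp').1 hlex
  have hag' : ∀ m, agreeAway t m p → agreeAway t (replacePart s m p') p' := by
    intro m hmp v hv
    by_cases hvs : v.1 = s
    · exact replacePart_apply_of_eq m p' hvs
    · rw [replacePart_apply_of_ne m p' hvs, hmp v hv, hag v hvs]
  obtain ⟨⟨m, hm, hmp⟩, hpok, hcard⟩ := hp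
  refine ⟨⟨_, hmem m hm hmp, hag' m hmp⟩, fun j hj => ?_, ?_⟩
  · rw [ht] at hj ⊢
    exact hpok j hj
  · have hdt : degOn t p' = degOn t p := degOn_congr ht
    have hlow : {q | q ∈ ColorMon S e t (degOn t p) ∧ lexLePart t q p'} =
        {q | q ∈ ColorMon S e t (degOn t p) ∧ lexLePart t q p} := by
      ext q
      exact and_congr_right fun _ => lexLePart_congr (fun _ => rfl) ht
    rw [hdt, hlow]
    refine hcard.trans (Set.ncard_le_ncard_of_injOn (fun m => replacePart s m p') ?_ ?_
      (hfin.subset fun m hm => hm.1))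
    · rintro m ⟨hm, hmp, hmd⟩
      exact ⟨hmem m hm hmp, hag' m hmp, (degOn_congr fun j =>
        replacePart_apply_of_ne m p' hst.symm).trans hmd⟩
    · rintro m ⟨-, hm, -⟩ m' ⟨-, hm', -⟩ h
      refine eq_of_agreeAway (agreeAway_trans hm (agreeAway_comm hm')) fun j => ?_
      have := DFunLike.congr_fun h (t, j)
      simpa only [replacePart_apply_of_ne _ p' (v := (t, j)) hst.symm] using this

/-- The invariants of a compression sequence: after the steps listed in `l` the multicomplex is
finite, within bounds, and initial in every color of `l`; no color is repeated. -/
lemma exists_nodup_foldl {M : Set (MCMon n)} (hfin : M.Finite)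
    (hbd : ∀ m ∈ M, InBounds S e m) {k : ℕ} (ts : Fin k → Fin n)
    (Ms : Fin (k + 1) → Set (MCMon n)) (h0 : Ms 0 = M)
    (hstep : ∀ i : Fin k, Ms i.succ = compressOp S e (Ms i.castSucc) (ts i) ∧
      Ms i.succ ≠ Ms i.castSucc) (i : Fin (k + 1)) :
    ∃ l : List (Fin n), l.Nodup ∧ Ms i = l.foldl (compressOp S e) M ∧ (Ms i).Finite ∧
      (∀ m ∈ Ms i, InBounds S e m) ∧ ∀ t ∈ l, IsInitial S e t (Ms i) := by
  induction i using Fin.induction with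
  | zero => exact ⟨[], by simp, by simpa using h0, h0 ▸ hfin, h0 ▸ hbd, by simp⟩
  | succ i ih =>
    obtain ⟨l, hnd, hl, hf, hb, hi⟩ := ih
    obtain ⟨hs, hne⟩ := hstep i
    have hnot : ts i ∉ l := fun h => hne (hs.trans (compressOp_eq_self hf hb (hi _ h)))
    refine ⟨l ++ [ts i], ?_, ?_, ?_, ?_, ?_⟩
    · exact List.nodup_append.2 ⟨hnd, by simp, by
        rintro a ha b hb rfl
        exact hnot (List.mem_singleton.1 hb ▸ ha)⟩
    · rw [List.foldl_append, ← hl, hs]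
      rfl
    · exact hs ▸ finite_compressOp hf hb _
    · exact hs ▸ inBounds_of_mem_compressOp hb
    · intro t ht
      rw [hs]
      rcases List.mem_append.1 ht with ht | ht
      · exact (hi t ht).compressOp hf fun h => hnot (h ▸ ht)
      · obtain rfl := List.mem_singleton.1 ht
        exact isInitial_compressOp _

lemma exists_perm_foldl {M M' : Set (MCMon n)} (hfin : M.Finite)
    (hbd : ∀ m ∈ M, InBounds S e m) (h : IsColorCompressionOf S e M M') :
    ∃ l : List (Fin n), l.Perm (List.finRange n) ∧ l.foldl (compressOp S e) M = M' := by
  obtain ⟨hfix, k, ts, Ms, h0, hlast, hstep⟩ := h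
  obtain ⟨l, hnd, hl, -⟩ := exists_nodup_foldl hfin hbd ts Ms h0 hstep (Fin.last k)
  refine ⟨l ++ (List.finRange n).filter (fun t => t ∉ l), ?_, ?_⟩
  · rw [List.perm_ext_iff_of_nodup ?_ (List.nodup_finRange n)]
    · intro t
      by_cases ht : t ∈ l <;> simp [ht]
    · refine List.nodup_append.2 ⟨hnd, (List.nodup_finRange n).filter _, ?_⟩
      rintro a ha b hb rfl
      exact (by simpa using hb : a ∉ l) ha
  · rw [List.foldl_append, ← hl, hlast]
    exact List.foldl_fixed' hfix _

end ColorCompression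

/-- A finite colored multicomplex of type `a` in
`𝓜_π(e₁,…,eₙ)` (with weakly decreasing bound sequences) has at most `n!`
color compressions. -/
theorem colorCompressions_le_factorial {n : ℕ} (hn : 0 < n)
    (S : Fin n → Set ℕ) (hS : ∀ i, (S i).Nonempty)
    (e : Fin n → ℕ → ℕ∞) (he : ∀ i, ∀ j ∈ S i, 1 ≤ e i j)
    (hmono : ∀ i, ∀ j ∈ S i, ∀ k ∈ S i, j ≤ k → e i k ≤ e i j)
    (a : Fin n → ℕ) (ha : ∀ i, 0 < a i) (M : Set (MCMon n))
    (hfin : M.Finite) (hmc : IsMulticomplex M)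
    (hbd : ∀ m ∈ M, InBounds S e m) (htype : IsColoredType a M) :
    {M' | IsColorCompressionOf S e M M'}.Finite ∧
      {M' | IsColorCompressionOf S e M M'}.ncard ≤ Nat.factorial n := by
  classical
  have hsub : {M' | IsColorCompressionOf S e M M'} ⊆
      (((List.finRange n).permutations.map fun l => l.foldl (compressOp S e) M).toFinset :
        Set (Set (MCMon n))) := by
    intro M' hM'
    obtain ⟨l, hl, hlM⟩ := ColorCompression.exists_perm_foldl hfin hbd hM'
    rw [Finset.mem_coe, List.mem_toFinset, List.mem_map]
    exact ⟨l, List.mem_permutations.2 hl, hlM⟩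
  refine ⟨(Finset.finite_toSet _).subset hsub, ?_⟩
  refine (Set.ncard_le_ncard hsub (Finset.finite_toSet _)).trans ?_
  rw [Set.ncard_coe_finset]
  refine (List.toFinset_card_le _).trans ?_
  rw [List.length_map, List.length_permutations, List.length_finRange]
end

section
/- Let a ∈ ℕ^n. Any a-rib of a simplex is vertex-decomposable. -/
open Finset

/-- The vertex set of a finite simplicial complex, given as its finite set of faces. -/
def vertexSet {α : Type*} [DecidableEq α] (Δ : Finset (Finset α)) : Finset α := Δ.sup id

/-- `Δ` is a (finite) simplicial complex: a nonempty collection of finite subsets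
closed under taking subsets.  (Every member of some face then automatically spans
a face, so the vertex condition is automatic.) -/
def IsSimplicialComplex {α : Type*} (Δ : Finset (Finset α)) : Prop :=
  Δ.Nonempty ∧ ∀ F ∈ Δ, ∀ G ⊆ F, G ∈ Δ

/-- The deletion `dl_Δ(x)` of the vertex `x` from `Δ`. -/
def del {α : Type*} [DecidableEq α] (Δ : Finset (Finset α)) (x : α) : Finset (Finset α) :=
  Δ.filter fun τ => x ∉ τ

/-- The link `lk_Δ(x)` of the vertex `x` in `Δ`. -/
def lk {α : Type*} [DecidableEq α] (Δ : Finset (Finset α)) (x : α) : Finset (Finset α) :=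
  Δ.filter fun τ => x ∉ τ ∧ insert x τ ∈ Δ

/-- `F` is a facet (maximal face) of `Δ`. -/
def IsFacet {α : Type*} (Δ : Finset (Finset α)) (F : Finset α) : Prop :=
  F ∈ Δ ∧ ∀ G ∈ Δ, F ⊆ G → G = F

/-- The simplicial complex `⟨ℱ⟩` generated by a collection `ℱ` of faces. -/
def generatedComplex {α : Type*} [DecidableEq α] (S : Finset (Finset α)) :
    Finset (Finset α) :=
  insert ∅ (S.biUnion Finset.powerset)

/-- `(V 0, …, V (n-1))` is an ordered partition of `W` into nonempty parts. -/
def IsOrderedPartition {α : Type*} [DecidableEq α] {n : ℕ} (V : Fin n → Finset α)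
    (W : Finset α) : Prop :=
  (∀ i, (V i).Nonempty) ∧ (∀ i j, i ≠ j → Disjoint (V i) (V j)) ∧
    Finset.univ.biUnion V = W

/-- `Γ` is an `a`-rib of `Δ`: there is an ordered partition `V` of the vertex set
of `Δ` such that `Γ` is generated by the faces `F` of `Δ` with `|F ∩ V i| = a i`
for every `i`. -/
def IsRib {α : Type*} [DecidableEq α] {n : ℕ} (a : Fin n → ℕ) (Δ Γ : Finset (Finset α)) :
    Prop :=
  ∃ V : Fin n → Finset α, IsOrderedPartition V (vertexSet Δ) ∧
    (Δ.filter fun F => ∀ i, (F ∩ V i).card = a i).Nonempty ∧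
    Γ = generatedComplex (Δ.filter fun F => ∀ i, (F ∩ V i).card = a i)

/-- `Γ` is an `a`-rib of a simplex. -/
def IsRibOfSimplex {α : Type*} [DecidableEq α] {n : ℕ} (a : Fin n → ℕ)
    (Γ : Finset (Finset α)) : Prop :=
  ∃ F : Finset α, F.Nonempty ∧ IsRib a F.powerset Γ

/-- Vertex decomposability, in the non-pure sense of Björner and Wachs. -/
inductive VertexDecomposable {α : Type*} [DecidableEq α] : Finset (Finset α) → Prop
  | simplex (F : Finset α) (hF : F.Nonempty) : VertexDecomposable F.powerset
  | ofEmpty : VertexDecomposable {∅}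
  | shed (Δ : Finset (Finset α)) (x : α) (hC : IsSimplicialComplex Δ) (hx : {x} ∈ Δ)
      (hdl : VertexDecomposable (del Δ x)) (hlk : VertexDecomposable (lk Δ x))
      (hfac : ∀ F, IsFacet (lk Δ x) F → ¬ IsFacet (del Δ x) F) :
      VertexDecomposable Δ

/-- `a`-Macaulay decomposability. -/
inductive MacaulayDecomposable {α : Type*} [DecidableEq α] {n : ℕ} :
    (Fin n → ℕ) → Finset (Finset α) → Prop
  | rib (a : Fin n → ℕ) (Γ : Finset (Finset α)) (h : IsRibOfSimplex a Γ) :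
      MacaulayDecomposable a Γ
  | shed (a a' : Fin n → ℕ) (Δ : Finset (Finset α)) (x : α)
      (hC : IsSimplicialComplex Δ) (hx : {x} ∈ Δ) (hlt : a' < a)
      (hdl : MacaulayDecomposable a (del Δ x))
      (hlk : MacaulayDecomposable a' (lk Δ x))
      (hfac : ∀ F, IsFacet (lk Δ x) F → ¬ IsFacet (del Δ x) F) :
      MacaulayDecomposable a Δ

/-- The complex of all subsets of `W` with at most `a i` elements in each `V i`. -/
def boundedComplex {α ι : Type*} [DecidableEq α] [Fintype ι] (V : ι → Finset α)
    (W : Finset α) (a : ι → ℕ) : Finset (Finset α) :=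
  W.powerset.filter fun G => ∀ i, (G ∩ V i).card ≤ a i

theorem mem_boundedComplex {α ι : Type*} [DecidableEq α] [Fintype ι] {V : ι → Finset α}
    {W : Finset α} {a : ι → ℕ} {G : Finset α} :
    G ∈ boundedComplex V W a ↔ G ⊆ W ∧ ∀ i, (G ∩ V i).card ≤ a i := by
  simp [boundedComplex]

theorem isSimplicialComplex_boundedComplex {α ι : Type*} [DecidableEq α] [Fintype ι]
    (V : ι → Finset α) (W : Finset α) (a : ι → ℕ) :
    IsSimplicialComplex (boundedComplex V W a) := by
  refine ⟨⟨∅, by simp [mem_boundedComplex]⟩, fun F hF G hG => ?_⟩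
  rw [mem_boundedComplex] at hF ⊢
  exact ⟨hG.trans hF.1, fun i =>
    (card_le_card (inter_subset_inter_right hG)).trans (hF.2 i)⟩

theorem del_boundedComplex {α ι : Type*} [DecidableEq α] [Fintype ι]
    (V : ι → Finset α) (W : Finset α) (a : ι → ℕ) (x : α) :
    del (boundedComplex V W a) x = boundedComplex V (W.erase x) a := by
  ext G
  simp only [del, mem_filter, mem_boundedComplex, subset_erase]
  tauto

theorem boundedComplex_erase_of_eq_zero {α ι : Type*} [DecidableEq α] [Fintype ι]
    {V : ι → Finset α} {W : Finset α} {a : ι → ℕ} {i : ι} {x : α} (hx : x ∈ V i)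
    (ha : a i = 0) : boundedComplex V (W.erase x) a = boundedComplex V W a := by
  ext G
  simp only [mem_boundedComplex, subset_erase]
  refine ⟨fun h => ⟨h.1.1, h.2⟩, fun h => ⟨⟨h.1, fun hxG => ?_⟩, h.2⟩⟩
  have hcard : 0 < (G ∩ V i).card := card_pos.2 ⟨x, mem_inter.2 ⟨hxG, hx⟩⟩
  have := h.2 i
  omega

theorem card_insert_inter_of_disjoint {α ι : Type*} [DecidableEq α] [DecidableEq ι]
    {V : ι → Finset α} (hV : ∀ i j, i ≠ j → Disjoint (V i) (V j)) {i : ι} {x : α}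
    (hx : x ∈ V i) {G : Finset α} (hxG : x ∉ G) (j : ι) :
    (insert x G ∩ V j).card = (G ∩ V j).card + if j = i then 1 else 0 := by
  split_ifs with hj
  · subst hj
    rw [insert_inter_of_mem hx, card_insert_of_notMem (by simp [hxG])]
  · rw [insert_inter_of_notMem (disjoint_left.1 (hV i j (Ne.symm hj)) hx), add_zero]

theorem lk_boundedComplex {α ι : Type*} [DecidableEq α] [Fintype ι] [DecidableEq ι]
    {V : ι → Finset α} (hV : ∀ i j, i ≠ j → Disjoint (V i) (V j)) {W : Finset α}
    {a : ι → ℕ} {i : ι} {x : α} (hxW : x ∈ W) (hx : x ∈ V i) (ha : a i ≠ 0) :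
    lk (boundedComplex V W a) x =
      boundedComplex V (W.erase x) (Function.update a i (a i - 1)) := by
  ext G
  simp only [lk, mem_filter, mem_boundedComplex, subset_erase, insert_subset_iff]
  constructor
  · rintro ⟨⟨hGW, -⟩, hxG, -, h⟩
    refine ⟨⟨hGW, hxG⟩, fun j => ?_⟩
    have hj := h j
    rw [card_insert_inter_of_disjoint hV hx hxG] at hj
    rw [Function.update_apply]
    split_ifs at hj ⊢ with hji
    · subst hji; omega
    · omega
  · rintro ⟨⟨hGW, hxG⟩, h⟩
    have key : ∀ j, (insert x G ∩ V j).card ≤ a j := fun j => by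
      have hj := h j
      rw [card_insert_inter_of_disjoint hV hx hxG]
      rw [Function.update_apply] at hj
      split_ifs at hj ⊢ with hji
      · subst hji; omega
      · omega
    exact ⟨⟨hGW, fun j => (card_le_card
      (inter_subset_inter_right (subset_insert x G))).trans (key j)⟩, hxG, ⟨hxW, hGW⟩, key⟩

theorem vertexDecomposable_boundedComplex {α ι : Type*} [DecidableEq α] [Fintype ι]
    {V : ι → Finset α} (hV : ∀ i j, i ≠ j → Disjoint (V i) (V j)) (W : Finset α)
    (a : ι → ℕ) : VertexDecomposable (boundedComplex V W a) := by
  classical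
  induction W using Finset.strongInduction generalizing a with
  | H W ih =>
  by_cases hsimplex : ∀ i, (W ∩ V i).card ≤ a i
  · have hpow : boundedComplex V W a = W.powerset := filter_true_of_mem fun G hG i =>
      (card_le_card (inter_subset_inter_right (mem_powerset.1 hG))).trans (hsimplex i)
    rw [hpow]
    rcases W.eq_empty_or_nonempty with rfl | hW
    · exact VertexDecomposable.ofEmpty
    · exact VertexDecomposable.simplex W hW
  push Not at hsimplex
  obtain ⟨i, hi⟩ := hsimplex
  obtain ⟨x, hx⟩ := card_pos.1 (Nat.zero_lt_of_lt hi)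
  obtain ⟨hxW, hxV⟩ := mem_inter.1 hx
  by_cases ha : a i = 0
  · rw [← boundedComplex_erase_of_eq_zero hxV ha]
    exact ih _ (erase_ssubset hxW) a
  refine VertexDecomposable.shed _ x (isSimplicialComplex_boundedComplex V W a) ?_ ?_ ?_ ?_
  · rw [mem_boundedComplex, singleton_subset_iff]
    refine ⟨hxW, fun j => ?_⟩
    have hj := card_insert_inter_of_disjoint hV hxV (notMem_empty x) j
    rw [insert_empty_eq, empty_inter, card_empty, zero_add] at hj
    rw [hj]
    split_ifs with hji
    · subst hji; omega
    · exact Nat.zero_le _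
  · rw [del_boundedComplex]
    exact ih _ (erase_ssubset hxW) _
  · rw [lk_boundedComplex hV hxW hxV ha]
    exact ih _ (erase_ssubset hxW) _
  · rw [lk_boundedComplex hV hxW hxV ha, del_boundedComplex]
    rintro F ⟨hF, -⟩ ⟨hF', hmax⟩
    rw [mem_boundedComplex] at hF hF'
    have hFi := hF.2 i
    rw [Function.update_self] at hFi
    have herase : (W.erase x ∩ V i).card = (W ∩ V i).card - 1 := by
      rw [erase_inter, card_erase_of_mem hx]
    obtain ⟨y, hyW, hyF⟩ := exists_mem_notMem_of_card_lt_card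
      (show (F ∩ V i).card < (W.erase x ∩ V i).card by omega)
    obtain ⟨hyW, hyV⟩ := mem_inter.1 hyW
    have hyF : y ∉ F := fun h => hyF (mem_inter.2 ⟨h, hyV⟩)
    refine hyF (insert_eq_self.1 (hmax (insert y F) ?_ (subset_insert y F)))
    rw [mem_boundedComplex, insert_subset_iff]
    refine ⟨⟨hyW, hF'.1⟩, fun j => ?_⟩
    rw [card_insert_inter_of_disjoint hV hyV hyF]
    split_ifs with hji
    · subst hji; omega
    · exact hF'.2 j

theorem generatedComplex_eq_boundedComplex {α : Type*} [DecidableEq α] {n : ℕ}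
    {a : Fin n → ℕ} {V : Fin n → Finset α} {W : Finset α} (hV : IsOrderedPartition V W)
    (hne : (W.powerset.filter fun F => ∀ i, (F ∩ V i).card = a i).Nonempty) :
    generatedComplex (W.powerset.filter fun F => ∀ i, (F ∩ V i).card = a i) =
      boundedComplex V W a := by
  obtain ⟨-, hdisj, hW⟩ := hV
  obtain ⟨B, hB⟩ := hne
  rw [mem_filter] at hB
  ext G
  simp only [generatedComplex, mem_insert, mem_biUnion, mem_filter, mem_powerset,
    mem_boundedComplex]
  constructor
  · rintro (rfl | ⟨F, ⟨hFW, hF⟩, hGF⟩)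
    · simp
    · exact ⟨hGF.trans hFW, fun i =>
        (card_le_card (inter_subset_inter_right hGF)).trans (hF i).le⟩
  · rintro ⟨hGW, hG⟩
    have hext : ∀ i, ∃ T, G ∩ V i ⊆ T ∧ T ⊆ V i ∧ T.card = a i := fun i =>
      exists_subsuperset_card_eq inter_subset_right (hG i)
        ((hB.2 i).symm.le.trans (card_le_card inter_subset_right))
    choose T hGT hTV hT using hext
    refine Or.inr ⟨univ.biUnion T, ⟨?_, fun i => ?_⟩, fun x hx => ?_⟩
    · rw [← hW]
      exact biUnion_mono fun i _ => hTV i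
    · rw [← hT i]
      congr 1
      ext x
      simp only [mem_inter, mem_biUnion, mem_univ, true_and]
      constructor
      · rintro ⟨⟨j, hj⟩, hxi⟩
        by_cases hji : j = i
        · exact hji ▸ hj
        · exact absurd hxi (disjoint_left.1 (hdisj j i hji) (hTV j hj))
      · exact fun h => ⟨⟨i, h⟩, hTV i h⟩
    · have hxW := hGW hx
      rw [← hW, mem_biUnion] at hxW
      obtain ⟨i, -, hi⟩ := hxW
      exact mem_biUnion.2 ⟨i, mem_univ i, hGT i (mem_inter.2 ⟨hx, hi⟩)⟩

theorem vertexSet_powerset {α : Type*} [DecidableEq α] (F : Finset α) :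
    vertexSet F.powerset = F :=
  le_antisymm (Finset.sup_le fun _ hG => mem_powerset.1 hG)
    (le_sup (f := id) (mem_powerset_self F))

/-- Any `a`-rib of a simplex is vertex-decomposable. -/
theorem ribOfSimplex_vertexDecomposable {α : Type*} [DecidableEq α] {n : ℕ}
    (a : Fin n → ℕ) (Γ : Finset (Finset α)) (h : IsRibOfSimplex a Γ) :
    VertexDecomposable Γ := by
  obtain ⟨W, -, V, hV, hne, rfl⟩ := h
  rw [vertexSet_powerset] at hV
  rw [generatedComplex_eq_boundedComplex hV hne]
  exact vertexDecomposable_boundedComplex hV.2.1 W a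
end

section
/- Let a ∈ ℕ^n and let Δ be a simplicial complex. If Δ is a-Macaulay decomposable, then Δ is vertex-decomposable, and every Macaulay shedding vertex of Δ is a shedding vertex of Δ. -/
open Finset

/-- `x` is a shedding vertex of `Δ`. -/
def IsSheddingVertex {α : Type*} [DecidableEq α] (Δ : Finset (Finset α)) (x : α) : Prop :=
  {x} ∈ Δ ∧ VertexDecomposable (del Δ x) ∧ VertexDecomposable (lk Δ x) ∧
    ∀ F, IsFacet (lk Δ x) F → ¬ IsFacet (del Δ x) F

/-- `x` is a Macaulay shedding vertex of `Δ` (for the type `a`). -/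
def IsMacaulaySheddingVertex {α : Type*} [DecidableEq α] {n : ℕ} (a : Fin n → ℕ)
    (Δ : Finset (Finset α)) (x : α) : Prop :=
  {x} ∈ Δ ∧ ∃ a' : Fin n → ℕ, a' < a ∧
    MacaulayDecomposable a (del Δ x) ∧ MacaulayDecomposable a' (lk Δ x) ∧
    ∀ F, IsFacet (lk Δ x) F → ¬ IsFacet (del Δ x) F

section BoundedFaces

variable {α ι : Type*} [DecidableEq α] {V : ι → Finset α} {W F : Finset α}
  {a : ι → ℕ} {x : α} {i : ι}

theorem card_insert_inter_le_iff [DecidableEq ι] (hV : Pairwise fun i j => Disjoint (V i) (V j))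
    (hx : x ∈ V i) (hxF : x ∉ F) (ha : 0 < a i) :
    (∀ j, (insert x F ∩ V j).card ≤ a j) ↔
      ∀ j, (F ∩ V j).card ≤ Function.update a i (a i - 1) j := by
  refine forall_congr' fun j => ?_
  obtain rfl | hj := eq_or_ne j i
  · rw [insert_inter_of_mem hx, card_insert_of_notMem (by simp [hxF]), Function.update_self]
    omega
  · rw [insert_inter_of_notMem (disjoint_left.1 (hV hj.symm) hx), Function.update_of_ne hj]

variable [Fintype ι]

/-- The subsets of `W` that meet each `V i` in at most `a i` elements. -/
def boundedFaces (V : ι → Finset α)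
    (W : Finset α) (a : ι → ℕ) : Finset (Finset α) :=
  W.powerset.filter fun F => ∀ i, (F ∩ V i).card ≤ a i

theorem mem_boundedFaces :
    F ∈ boundedFaces V W a ↔ F ⊆ W ∧ ∀ i, (F ∩ V i).card ≤ a i := by
  simp [boundedFaces]

theorem isSimplicialComplex_boundedFaces : IsSimplicialComplex (boundedFaces V W a) := by
  refine ⟨⟨∅, by simp [mem_boundedFaces]⟩, fun F hF G hGF => ?_⟩
  rw [mem_boundedFaces] at hF ⊢
  exact ⟨hGF.trans hF.1, fun i =>
    (card_le_card (inter_subset_inter_right hGF)).trans (hF.2 i)⟩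

theorem del_boundedFaces : del (boundedFaces V W a) x = boundedFaces V (W.erase x) a := by
  ext F
  simp only [del, mem_filter, mem_boundedFaces, subset_erase]
  tauto

theorem boundedFaces_erase_of_eq_zero (hx : x ∈ V i) (ha : a i = 0) :
    boundedFaces V (W.erase x) a = boundedFaces V W a := by
  ext F
  simp only [mem_boundedFaces, subset_erase]
  refine ⟨fun h => ⟨h.1.1, h.2⟩, fun h => ⟨⟨h.1, fun hxF => ?_⟩, h.2⟩⟩
  have hi := h.2 i
  rw [ha, Nat.le_zero, card_eq_zero] at hi
  exact notMem_empty x (hi ▸ mem_inter.2 ⟨hxF, hx⟩)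

theorem lk_boundedFaces [DecidableEq ι] (hV : Pairwise fun i j => Disjoint (V i) (V j))
    (hxW : x ∈ W) (hx : x ∈ V i) (ha : 0 < a i) :
    lk (boundedFaces V W a) x =
      boundedFaces V (W.erase x) (Function.update a i (a i - 1)) := by
  ext F
  simp only [lk, mem_filter, mem_boundedFaces, subset_erase, insert_subset_iff]
  constructor
  · rintro ⟨⟨hFW, -⟩, hxF, -, hF⟩
    exact ⟨⟨hFW, hxF⟩, (card_insert_inter_le_iff hV hx hxF ha).1 hF⟩
  · rintro ⟨⟨hFW, hxF⟩, hF⟩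
    have h := (card_insert_inter_le_iff hV hx hxF ha).2 hF
    exact ⟨⟨hFW, fun j => (card_le_card (inter_subset_inter_right (subset_insert x F))).trans
      (h j)⟩, hxF, ⟨hxW, hFW⟩, h⟩

theorem not_isFacet_boundedFaces [DecidableEq ι]
    (hV : Pairwise fun i j => Disjoint (V i) (V j)) (ha : 0 < a i) (hW : a i ≤ (W ∩ V i).card)
    (hF : F ∈ boundedFaces V W (Function.update a i (a i - 1))) :
    ¬ IsFacet (boundedFaces V W a) F := by
  rw [mem_boundedFaces] at hF
  have hFi := hF.2 i
  rw [Function.update_self] at hFi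
  obtain ⟨y, hy, hyF⟩ := exists_mem_notMem_of_card_lt_card
    (show (F ∩ V i).card < (W ∩ V i).card by omega)
  rw [mem_inter] at hy
  have hyF : y ∉ F := fun h => hyF (mem_inter.2 ⟨h, hy.2⟩)
  intro hfac
  have h := hfac.2 (insert y F) (mem_boundedFaces.2 ⟨insert_subset hy.1 hF.1,
    (card_insert_inter_le_iff hV hy.2 hyF ha).2 hF.2⟩) (subset_insert y F)
  exact hyF (h ▸ mem_insert_self y F)

theorem vertexDecomposable_powerset (F : Finset α) : VertexDecomposable F.powerset := by
  obtain rfl | hF := F.eq_empty_or_nonempty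
  · exact .ofEmpty
  · exact .simplex F hF

theorem vertexDecomposable_boundedFaces (hV : Pairwise fun i j => Disjoint (V i) (V j))
    (W : Finset α) (a : ι → ℕ) : VertexDecomposable (boundedFaces V W a) := by
  classical
  induction W using Finset.strongInduction generalizing a with
  | H W ih =>
    by_cases hW : ∀ i, (W ∩ V i).card ≤ a i
    · have h : boundedFaces V W a = W.powerset := by
        ext F
        rw [mem_boundedFaces, mem_powerset, and_iff_left_iff_imp]
        exact fun hF i => (card_le_card (inter_subset_inter_right hF)).trans (hW i)
      exact h ▸ vertexDecomposable_powerset W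
    · push Not at hW
      obtain ⟨i, hi⟩ := hW
      obtain ⟨x, hx⟩ := card_pos.1 (Nat.zero_lt_of_lt hi)
      have hxWV := mem_inter.1 hx
      obtain ha | ha := (a i).eq_zero_or_pos
      · exact boundedFaces_erase_of_eq_zero (W := W) hxWV.2 ha ▸
          ih _ (erase_ssubset hxWV.1) a
      · have hlk := lk_boundedFaces hV hxWV.1 hxWV.2 ha
        refine .shed _ x isSimplicialComplex_boundedFaces ?_ ?_ ?_ fun F hF => ?_
        · rw [mem_boundedFaces, singleton_subset_iff, ← insert_empty_eq,
            card_insert_inter_le_iff hV hxWV.2 (notMem_empty x) ha]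
          simp [hxWV.1]
        · exact del_boundedFaces (V := V) (a := a) ▸ ih _ (erase_ssubset hxWV.1) a
        · exact hlk ▸ ih _ (erase_ssubset hxWV.1) _
        · rw [del_boundedFaces]
          refine not_isFacet_boundedFaces hV ha ?_ (hlk ▸ hF.1)
          rw [erase_inter, card_erase_of_mem hx]
          omega

end BoundedFaces

theorem IsRib.eq_boundedFaces {α : Type*} [DecidableEq α] {n : ℕ} {a : Fin n → ℕ}
    {F : Finset α} {Γ : Finset (Finset α)} (h : IsRib a F.powerset Γ) :
    ∃ V : Fin n → Finset α, (Pairwise fun i j => Disjoint (V i) (V j)) ∧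
      Γ = boundedFaces V F a := by
  obtain ⟨V, ⟨-, hV, hVF⟩, ⟨H, hH⟩, rfl⟩ := h
  rw [vertexSet_powerset] at hVF
  refine ⟨V, fun i j => hV i j, ?_⟩
  have haV : ∀ i, a i ≤ (V i).card := fun i =>
    (mem_filter.1 hH).2 i ▸ card_le_card inter_subset_right
  ext G
  simp only [generatedComplex, mem_insert, mem_biUnion, mem_filter, mem_powerset,
    mem_boundedFaces]
  constructor
  · rintro (rfl | ⟨K, ⟨hKF, hK⟩, hGK⟩)
    · simp
    · exact ⟨hGK.trans hKF, fun i => hK i ▸ card_le_card (inter_subset_inter_right hGK)⟩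
  · rintro ⟨hGF, hG⟩
    choose K hGK hKV hK using fun i =>
      exists_subsuperset_card_eq (inter_subset_right (s₁ := G) (s₂ := V i)) (hG i) (haV i)
    refine Or.inr ⟨univ.biUnion K, ⟨?_, fun i => ?_⟩, fun x hx => ?_⟩
    · rw [← hVF]
      exact biUnion_mono fun i _ => hKV i
    · rw [← hK i]
      congr 1
      ext x
      simp only [mem_inter, mem_biUnion, mem_univ, true_and]
      refine ⟨fun ⟨⟨j, hj⟩, hxi⟩ => ?_, fun hx => ⟨⟨i, hx⟩, hKV i hx⟩⟩
      obtain rfl | hij := eq_or_ne j i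
      · exact hj
      · exact absurd hxi (disjoint_left.1 (hV j i hij) (hKV j hj))
    · obtain ⟨i, -, hi⟩ := mem_biUnion.1 (hVF.symm ▸ hGF hx : x ∈ univ.biUnion V)
      exact mem_biUnion.2 ⟨i, mem_univ i, hGK i (mem_inter.2 ⟨hx, hi⟩)⟩

theorem IsRibOfSimplex.vertexDecomposable {α : Type*} [DecidableEq α] {n : ℕ}
    {a : Fin n → ℕ} {Γ : Finset (Finset α)} (h : IsRibOfSimplex a Γ) :
    VertexDecomposable Γ := by
  obtain ⟨F, -, hF⟩ := h
  obtain ⟨V, hV, rfl⟩ := hF.eq_boundedFaces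
  exact vertexDecomposable_boundedFaces hV F a

theorem MacaulayDecomposable.vertexDecomposable {α : Type*} [DecidableEq α] {n : ℕ}
    {a : Fin n → ℕ} {Δ : Finset (Finset α)} (h : MacaulayDecomposable a Δ) :
    VertexDecomposable Δ := by
  induction h with
  | rib a Γ h => exact h.vertexDecomposable
  | shed a a' Δ x hC hx _ _ _ hfac hdl hlk => exact .shed Δ x hC hx hdl hlk hfac

/-- An `a`-Macaulay decomposable complex is vertex-decomposable,
and every Macaulay shedding vertex is a shedding vertex. -/
theorem macaulayDecomposable_vertexDecomposable {α : Type*} [DecidableEq α] {n : ℕ}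
    (a : Fin n → ℕ) (Δ : Finset (Finset α)) (h : MacaulayDecomposable a Δ) :
    VertexDecomposable Δ ∧
      ∀ x : α, IsMacaulaySheddingVertex a Δ x → IsSheddingVertex Δ x := by
  refine ⟨h.vertexDecomposable, fun x hx => ?_⟩
  obtain ⟨hxΔ, a', -, hdl, hlk, hfac⟩ := hx
  exact ⟨hxΔ, hdl.vertexDecomposable, hlk.vertexDecomposable, hfac⟩
end

section
/- Let a ∈ ℕ^n. Every a-Macaulay decomposable simplicial complex is shellable (in the non-pure sense of Björner–Wachs). -/
open Finset

/-- Shellability, in the non-pure sense of Björner and Wachs: the facets can be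
listed as `F_1, …, F_t` so that `⟨{F_{k+1}}⟩ ∩ ⟨{F_1,…,F_k}⟩` is pure of
dimension `dim F_{k+1} - 1` for every `k ∈ [t-1]`. -/
def Shellable {α : Type*} [DecidableEq α] (Δ : Finset (Finset α)) : Prop :=
  ∃ L : List (Finset α), L.Nodup ∧ (∀ F, IsFacet Δ F ↔ F ∈ L) ∧
    ∀ (k : ℕ) (h : k + 1 < L.length) (F : Finset α),
      IsFacet ((L.get ⟨k + 1, h⟩).powerset ∩ generatedComplex (L.take (k + 1)).toFinset) F →
        F.card + 1 = (L.get ⟨k + 1, h⟩).card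

/-- A family of finite sets admitting a shelling order: it is built by adding one set `F` at a
time, where every earlier `G` misses some `v ∈ F` such that `F \ {v}` lies in an earlier set. -/
inductive ShellableFamily {α : Type*} [DecidableEq α] : Finset (Finset α) → Prop
  | empty : ShellableFamily ∅
  | cons (S : Finset (Finset α)) (F : Finset α) (hS : ShellableFamily S) (hF : F ∉ S)
      (hstep : ∀ G ∈ S, ∃ H ∈ S, ∃ v ∈ F, F.erase v ⊆ H ∧ v ∉ G) :
      ShellableFamily (insert F S)

theorem mem_generatedComplex {α : Type*} [DecidableEq α] {S : Finset (Finset α)}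
    {T : Finset α} : T ∈ generatedComplex S ↔ T = ∅ ∨ ∃ F ∈ S, T ⊆ F := by
  simp [generatedComplex]

theorem mem_generatedComplex_of_nonempty {α : Type*} [DecidableEq α] {S : Finset (Finset α)}
    (hS : S.Nonempty) {T : Finset α} : T ∈ generatedComplex S ↔ ∃ F ∈ S, T ⊆ F := by
  rw [mem_generatedComplex]
  refine ⟨?_, Or.inr⟩
  rintro (rfl | h)
  · obtain ⟨F, hF⟩ := hS
    exact ⟨F, hF, empty_subset F⟩
  · exact h

/-- The facets of the intersection of a simplex with the complex generated by the earlier sets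
of a shelling have codimension one. -/
theorem card_add_one_of_isFacet_powerset_inter {α : Type*} [DecidableEq α]
    {S : Finset (Finset α)} {F T : Finset α} (hS : S.Nonempty)
    (hstep : ∀ G ∈ S, ∃ H ∈ S, ∃ v ∈ F, F.erase v ⊆ H ∧ v ∉ G)
    (hT : IsFacet (F.powerset ∩ generatedComplex S) T) : T.card + 1 = F.card := by
  obtain ⟨hT, hmax⟩ := hT
  rw [mem_inter, mem_powerset, mem_generatedComplex_of_nonempty hS] at hT
  obtain ⟨hTF, G, hG, hTG⟩ := hT
  obtain ⟨H, hH, v, hv, hvH, hvG⟩ := hstep G hG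
  have hmem : F.erase v ∈ F.powerset ∩ generatedComplex S := by
    rw [mem_inter, mem_powerset, mem_generatedComplex_of_nonempty hS]
    exact ⟨erase_subset v F, H, hH, hvH⟩
  rw [← hmax _ hmem (subset_erase.2 ⟨hTF, fun h => hvG (hTG h)⟩)]
  exact card_erase_add_one hv

theorem ShellableFamily.exists_list {α : Type*} [DecidableEq α] {S : Finset (Finset α)}
    (hS : ShellableFamily S) :
    ∃ L : List (Finset α), L.Nodup ∧ L.toFinset = S ∧
      ∀ (k : ℕ) (h : k + 1 < L.length) (F : Finset α),
        IsFacet ((L.get ⟨k + 1, h⟩).powerset ∩ generatedComplex (L.take (k + 1)).toFinset) F →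
          F.card + 1 = (L.get ⟨k + 1, h⟩).card := by
  induction hS with
  | empty => exact ⟨[], by simp⟩
  | cons S F hS hF hstep ih =>
    obtain ⟨L, hnd, rfl, hL⟩ := ih
    rw [List.mem_toFinset] at hF
    refine ⟨L ++ [F], ?_, ?_, ?_⟩
    · exact List.nodup_append.2 ⟨hnd, List.nodup_singleton F, by grind⟩
    · ext G
      simp
    · intro k hk T hT
      simp only [List.length_append, List.length_singleton] at hk
      simp only [List.get_eq_getElem] at hT hL ⊢
      rcases Nat.lt_succ_iff_lt_or_eq.1 hk with hlt | heq
      · rw [List.getElem_append_left hlt] at hT ⊢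
        rw [List.take_append_of_le_length hlt.le] at hT
        exact hL k hlt T hT
      · have hget : ∀ h, (L ++ [F])[k + 1]'h = F := by
          intro h
          simp [heq]
        rw [hget] at hT ⊢
        rw [List.take_left' heq.symm] at hT
        refine card_add_one_of_isFacet_powerset_inter ?_ hstep hT
        rw [List.toFinset_nonempty_iff]
        rintro rfl
        simp at heq

theorem ShellableFamily.shellable {α : Type*} [DecidableEq α] {S Δ : Finset (Finset α)}
    (hS : ShellableFamily S) (hΔ : ∀ F, IsFacet Δ F ↔ F ∈ S) : Shellable Δ := by
  obtain ⟨L, hnd, rfl, hL⟩ := hS.exists_list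
  exact ⟨L, hnd, fun F => by rw [hΔ, List.mem_toFinset], hL⟩

/-- A shelling of `S₁` followed by a shelling of the cone over `S₂` with new apex `x`. -/
theorem ShellableFamily.union_image_insert {α : Type*} [DecidableEq α]
    {S₁ S₂ : Finset (Finset α)} {x : α} (h₁ : ShellableFamily S₁) (h₂ : ShellableFamily S₂)
    (hx₁ : ∀ F ∈ S₁, x ∉ F) (hx₂ : ∀ F ∈ S₂, x ∉ F)
    (hext : ∀ F ∈ S₂, ∀ _G ∈ S₁, ∃ H ∈ S₁, F ⊆ H) :
    ShellableFamily (S₁ ∪ S₂.image (insert x)) := by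
  induction h₂ with
  | empty => simpa using h₁
  | cons S F hS hF hstep ih =>
    have hxF : x ∉ F := hx₂ F (mem_insert_self F S)
    rw [image_insert, union_insert]
    refine .cons _ _ (ih (fun G hG => hx₂ G (mem_insert_of_mem hG))
      fun G hG => hext G (mem_insert_of_mem hG)) ?_ ?_
    · rw [mem_union, mem_image]
      rintro (h | ⟨G, hG, hGF⟩)
      · exact hx₁ _ h (mem_insert_self x F)
      · have hxG : x ∉ G := hx₂ G (mem_insert_of_mem hG)
        have : G = F := by rw [← erase_insert hxG, hGF, erase_insert hxF]
        exact hF (this ▸ hG)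
    · intro G hG
      rcases mem_union.1 hG with hG | hG
      · obtain ⟨H, hH, hFH⟩ := hext F (mem_insert_self F S) G hG
        refine ⟨H, mem_union_left _ hH, x, mem_insert_self x F, ?_, hx₁ G hG⟩
        rwa [erase_insert hxF]
      · obtain ⟨G, hGS, rfl⟩ := mem_image.1 hG
        obtain ⟨H, hH, v, hv, hvH, hvG⟩ := hstep G hGS
        have hvx : v ≠ x := fun h => hxF (h ▸ hv)
        refine ⟨insert x H, mem_union_right _ (mem_image_of_mem _ hH), v,
          mem_insert_of_mem hv, ?_, ?_⟩
        · rw [erase_insert_of_ne hvx.symm]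
          exact insert_subset_insert x hvH
        · simp [hvx, hvG]

/-- The basis exchange property for a family of finite sets. -/
def HasBasisExchange {α : Type*} [DecidableEq α] (B : Finset (Finset α)) : Prop :=
  ∀ F ∈ B, ∀ G ∈ B, ∀ x ∈ F, x ∉ G → ∃ y ∈ G, y ∉ F ∧ insert y (F.erase x) ∈ B

theorem HasBasisExchange.eq_of_subset {α : Type*} [DecidableEq α] {B : Finset (Finset α)}
    (hB : HasBasisExchange B) {F G : Finset α} (hF : F ∈ B) (hG : G ∈ B) (h : F ⊆ G) :
    G = F := by
  refine Subset.antisymm (fun x hx => ?_) h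
  by_contra hxF
  obtain ⟨y, hy, hyG, -⟩ := hB G hG F hF x hx hxF
  exact hyG (h hy)

theorem HasBasisExchange.isFacet_generatedComplex_iff {α : Type*} [DecidableEq α]
    {B : Finset (Finset α)} (hB : HasBasisExchange B) (hne : B.Nonempty) (F : Finset α) :
    IsFacet (generatedComplex B) F ↔ F ∈ B := by
  simp only [IsFacet, mem_generatedComplex_of_nonempty hne]
  constructor
  · rintro ⟨⟨G, hG, hFG⟩, hmax⟩
    rwa [← hmax G ⟨G, hG, Subset.rfl⟩ hFG]
  · rintro hF
    refine ⟨⟨F, hF, Subset.rfl⟩, ?_⟩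
    rintro G ⟨H, hH, hGH⟩ hFG
    have := hB.eq_of_subset hF hH (hFG.trans hGH)
    exact Subset.antisymm (this ▸ hGH) hFG

theorem filter_notMem_union_image_insert {α : Type*} [DecidableEq α]
    (B : Finset (Finset α)) (x : α) :
    B.filter (x ∉ ·) ∪ ((B.filter (x ∈ ·)).image (erase · x)).image (insert x) = B := by
  have : ((B.filter (x ∈ ·)).image (erase · x)).image (insert x) = B.filter (x ∈ ·) := by
    rw [image_image]
    refine (image_congr fun F hF => ?_).trans image_id
    exact insert_erase (mem_filter.1 hF).2
  rw [this, union_comm, filter_union_filter_not_eq]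

theorem HasBasisExchange.shellableFamily {α : Type*} [DecidableEq α] (W : Finset α)
    {B : Finset (Finset α)} (hB : HasBasisExchange B) (hW : ∀ F ∈ B, F ⊆ W) :
    ShellableFamily B := by
  induction W using Finset.induction_on generalizing B with
  | empty =>
    have hsub : B ⊆ {∅} := fun F hF => mem_singleton.2 (subset_empty.1 (hW F hF))
    rcases subset_singleton_iff.1 hsub with rfl | rfl
    · exact .empty
    · exact .cons ∅ ∅ .empty (notMem_empty _) (by simp)
  | insert x W _ ih =>
    rw [← filter_notMem_union_image_insert B x]
    apply ShellableFamily.union_image_insert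
    · refine ih ?_ fun F hF => ?_
      · intro F hF G hG z hz hzG
        rw [mem_filter] at hF hG
        obtain ⟨y, hy, hyF, hmem⟩ := hB F hF.1 G hG.1 z hz hzG
        refine ⟨y, hy, hyF, mem_filter.2 ⟨hmem, ?_⟩⟩
        grind
      · rw [mem_filter] at hF
        exact (subset_insert_iff_of_notMem hF.2).1 (hW F hF.1)
    · refine ih ?_ fun F hF => ?_
      · simp only [HasBasisExchange, forall_mem_image, mem_filter, and_imp]
        intro F hF hxF G hG hxG z hz hzG
        have hzx : z ≠ x := (mem_erase.1 hz).1
        obtain ⟨y, hy, hyF, hmem⟩ := hB F hF G hG z (mem_of_mem_erase hz)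
          fun h => hzG (mem_erase.2 ⟨hzx, h⟩)
        have hyx : y ≠ x := fun h => hyF (h ▸ hxF)
        refine ⟨y, mem_erase.2 ⟨hyx, hy⟩, fun h => hyF (mem_of_mem_erase h),
          mem_image.2 ⟨_, mem_filter.2 ⟨hmem, ?_⟩, ?_⟩⟩
        · grind
        · rw [erase_insert_of_ne hyx, erase_right_comm]
      · obtain ⟨G, hG, rfl⟩ := mem_image.1 hF
        exact subset_insert_iff.1 (hW G (mem_filter.1 hG).1)
    · exact fun F hF => (mem_filter.1 hF).2
    · exact forall_mem_image.2 fun F _ => notMem_erase x F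
    · simp only [forall_mem_image, mem_filter, and_imp]
      intro F hF hxF G hG hxG
      obtain ⟨y, hy, hyF, hmem⟩ := hB F hF G hG x hxF hxG
      refine ⟨_, ⟨hmem, ?_⟩, subset_insert y _⟩
      grind

/-- Transversals of prescribed sizes form the bases of a partition matroid. -/
theorem hasBasisExchange_filter_card_inter {α : Type*} [DecidableEq α] {n : ℕ}
    (a : Fin n → ℕ) {V : Fin n → Finset α} {W : Finset α} (hV : IsOrderedPartition V W) :
    HasBasisExchange (W.powerset.filter fun F => ∀ i, (F ∩ V i).card = a i) := by
  obtain ⟨-, hdisj, rfl⟩ := hV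
  simp only [HasBasisExchange, mem_filter, mem_powerset]
  rintro F ⟨hFW, hF⟩ G ⟨hGW, hG⟩ x hxF hxG
  obtain ⟨i, -, hxi⟩ := mem_biUnion.1 (hFW hxF)
  obtain ⟨y, hyG, hyF⟩ : ∃ y ∈ G ∩ V i, y ∉ F ∩ V i := by
    by_contra! h
    have heq := eq_of_subset_of_card_le h (by rw [hF, hG])
    have hx : x ∈ G ∩ V i := heq ▸ mem_inter.2 ⟨hxF, hxi⟩
    exact hxG (mem_inter.1 hx).1
  rw [mem_inter] at hyG
  have hyF : y ∉ F := fun h => hyF (mem_inter.2 ⟨h, hyG.2⟩)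
  refine ⟨y, hyG.1, hyF, insert_subset (hGW hyG.1) ((erase_subset x F).trans hFW), fun j => ?_⟩
  rw [← hF j]
  by_cases hij : i = j
  · subst hij
    rw [insert_inter_of_mem hyG.2, erase_inter, card_insert_of_notMem (by simp [hyF]),
      card_erase_add_one (mem_inter.2 ⟨hxF, hxi⟩)]
  · have hxj : x ∉ V j := disjoint_left.1 (hdisj i j hij) hxi
    have hyj : y ∉ V j := disjoint_left.1 (hdisj i j hij) hyG.2
    rw [insert_inter_of_notMem hyj, erase_inter, erase_eq_of_notMem (by simp [hxj])]

theorem IsRibOfSimplex.exists_shellableFamily {α : Type*} [DecidableEq α] {n : ℕ}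
    {a : Fin n → ℕ} {Γ : Finset (Finset α)} (h : IsRibOfSimplex a Γ) :
    ∃ S, ShellableFamily S ∧ ∀ F, IsFacet Γ F ↔ F ∈ S := by
  obtain ⟨W, -, V, hV, hne, rfl⟩ := h
  have hW : vertexSet W.powerset = W :=
    le_antisymm (Finset.sup_le fun F hF => mem_powerset.1 hF)
      (le_sup (f := id) (mem_powerset_self W))
  rw [hW] at hV
  have hB := hasBasisExchange_filter_card_inter a hV
  exact ⟨_, hB.shellableFamily W fun F hF => mem_powerset.1 (mem_filter.1 hF).1,
    hB.isFacet_generatedComplex_iff hne⟩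

theorem exists_isFacet_superset {α : Type*} {Δ : Finset (Finset α)} {F : Finset α}
    (hF : F ∈ Δ) : ∃ G, IsFacet Δ G ∧ F ⊆ G := by
  obtain ⟨G, hFG, hG⟩ := Δ.exists_le_maximal hF
  exact ⟨G, ⟨hG.prop, fun H hH hGH => (hG.eq_of_le hH hGH).symm⟩, hFG⟩

/-- The facets of `Δ` are those of the deletion of a shedding vertex `x`, together with the
cones with apex `x` over those of its link. -/
theorem isFacet_iff_of_shedding {α : Type*} [DecidableEq α] {Δ : Finset (Finset α)} {x : α}
    (hC : IsSimplicialComplex Δ)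
    (hfac : ∀ F, IsFacet (lk Δ x) F → ¬ IsFacet (del Δ x) F) (F : Finset α) :
    IsFacet Δ F ↔ IsFacet (del Δ x) F ∨ ∃ G, IsFacet (lk Δ x) G ∧ insert x G = F := by
  constructor
  · rintro ⟨hF, hmax⟩
    by_cases hx : x ∈ F
    · refine Or.inr ⟨F.erase x, ⟨?_, ?_⟩, insert_erase hx⟩
      · simp [lk, insert_erase hx, hF, hC.2 F hF _ (erase_subset x F)]
      · intro G hG hFG
        simp only [lk, mem_filter] at hG
        rw [← hmax _ hG.2.2 (subset_insert_iff.2 hFG), erase_insert hG.2.1]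
    · refine Or.inl ⟨mem_filter.2 ⟨hF, hx⟩, fun G hG => hmax G (mem_filter.1 hG).1⟩
  · rintro (hF | ⟨G, ⟨hG, hmax⟩, rfl⟩)
    · obtain ⟨hmem, hmax⟩ := id hF
      simp only [del, mem_filter] at hmem hmax
      refine ⟨hmem.1, fun G hG hFG => ?_⟩
      by_cases hx : x ∈ G
      · have hins : insert x F ∈ Δ := hC.2 G hG _ (insert_subset hx hFG)
        refine absurd hF (hfac F ⟨mem_filter.2 ⟨hmem.1, hmem.2, hins⟩, fun H hH => ?_⟩)
        simp only [lk, mem_filter] at hH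
        exact hmax H ⟨hH.1, hH.2.1⟩
      · exact hmax G ⟨hG, hx⟩ hFG
    · simp only [lk, mem_filter] at hG hmax
      refine ⟨hG.2.2, fun H hH hGH => ?_⟩
      have hxH : x ∈ H := hGH (mem_insert_self x G)
      have hins := insert_erase hxH
      rw [← hmax (H.erase x) ⟨hC.2 H hH _ (erase_subset x H), notMem_erase x H,
        hins.symm ▸ hH⟩ (subset_erase.2 ⟨(subset_insert x G).trans hGH, hG.2.1⟩), hins]

theorem MacaulayDecomposable.exists_shellableFamily {α : Type*} [DecidableEq α] {n : ℕ}
    {a : Fin n → ℕ} {Δ : Finset (Finset α)} (h : MacaulayDecomposable a Δ) :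
    ∃ S, ShellableFamily S ∧ ∀ F, IsFacet Δ F ↔ F ∈ S := by
  induction h with
  | rib a Γ h => exact h.exists_shellableFamily
  | shed a a' Δ x hC _ _ _ _ hfac ihdl ihlk =>
    obtain ⟨S₁, hS₁, hmem₁⟩ := ihdl
    obtain ⟨S₂, hS₂, hmem₂⟩ := ihlk
    refine ⟨S₁ ∪ S₂.image (insert x), hS₁.union_image_insert hS₂ ?_ ?_ ?_, fun F => ?_⟩
    · exact fun F hF => (mem_filter.1 ((hmem₁ F).2 hF).1).2
    · exact fun F hF => (mem_filter.1 ((hmem₂ F).2 hF).1).2.1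
    · intro F hF _ _
      have hFlk := mem_filter.1 ((hmem₂ F).2 hF).1
      obtain ⟨H, hH, hFH⟩ :=
        exists_isFacet_superset (Δ := del Δ x) (mem_filter.2 ⟨hFlk.1, hFlk.2.1⟩)
      exact ⟨H, (hmem₁ H).1 hH, hFH⟩
    · simp only [isFacet_iff_of_shedding hC hfac, hmem₁, hmem₂, mem_union, mem_image]

/-- Every `a`-Macaulay decomposable simplicial complex is
shellable. -/
theorem macaulayDecomposable_shellable {α : Type*} [DecidableEq α] {n : ℕ}
    (a : Fin n → ℕ) (Δ : Finset (Finset α)) (h : MacaulayDecomposable a Δ) :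
    Shellable Δ := by
  obtain ⟨S, hS, hfacets⟩ := h.exists_shellableFamily
  exact hS.shellable hfacets
end

section
/- Let a ∈ ℕ^n. If Δ is an a-Macaulay decomposable simplicial complex, then dim Δ = |a| − 1, where |a| = a_1 + ⋯ + a_n. -/
open Finset

theorem IsOrderedPartition.card_eq_sum_card_inter {α : Type*} [DecidableEq α] {n : ℕ}
    {V : Fin n → Finset α} {W G : Finset α} (hV : IsOrderedPartition V W) (hG : G ⊆ W) :
    G.card = ∑ i, (G ∩ V i).card := by
  obtain ⟨-, hdisj, hunion⟩ := hV
  rw [← Finset.card_biUnion fun i _ j _ hij =>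
      (hdisj i j hij).mono Finset.inter_subset_right Finset.inter_subset_right,
    ← Finset.inter_biUnion, hunion, Finset.inter_eq_left.mpr hG]

theorem IsRibOfSimplex.dim {α : Type*} [DecidableEq α] {n : ℕ} {a : Fin n → ℕ}
    {Γ : Finset (Finset α)} (h : IsRibOfSimplex a Γ) :
    (∀ F ∈ Γ, F.card ≤ ∑ i, a i) ∧ ∃ F ∈ Γ, F.card = ∑ i, a i := by
  obtain ⟨W, -, V, hV, ⟨G, hG⟩, rfl⟩ := h
  rw [vertexSet_powerset] at hV
  have hcard : ∀ G ∈ W.powerset.filter fun F => ∀ i, (F ∩ V i).card = a i,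
      G.card = ∑ i, a i := by
    intro G hG
    obtain ⟨hGW, hGa⟩ := Finset.mem_filter.mp hG
    rw [hV.card_eq_sum_card_inter (Finset.mem_powerset.mp hGW)]
    exact Finset.sum_congr rfl fun i _ => hGa i
  refine ⟨fun F hF => ?_, G, ?_, hcard G hG⟩
  · rcases Finset.mem_insert.mp hF with rfl | hF
    · simp
    · obtain ⟨H, hH, hFH⟩ := Finset.mem_biUnion.mp hF
      exact (Finset.card_le_card (Finset.mem_powerset.mp hFH)).trans (hcard H hH).le
  · exact Finset.mem_insert_of_mem
      (Finset.mem_biUnion.mpr ⟨G, hG, Finset.mem_powerset_self G⟩)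

/-- An `a`-Macaulay decomposable simplicial complex has
dimension `|a| - 1`, i.e. its largest faces have exactly `|a|` vertices. -/
theorem macaulayDecomposable_dim {α : Type*} [DecidableEq α] {n : ℕ}
    (a : Fin n → ℕ) (Δ : Finset (Finset α)) (h : MacaulayDecomposable a Δ) :
    (∀ F ∈ Δ, F.card ≤ ∑ i, a i) ∧ ∃ F ∈ Δ, F.card = ∑ i, a i := by
  induction h with
  | rib a Γ h => exact h.dim
  | shed a a' Δ x hC hx hlt hdl hlk hfac ihdl ihlk =>
    refine ⟨fun F hF => ?_, ?_⟩
    · by_cases hxF : x ∈ F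
      · have hmem : F.erase x ∈ lk Δ x := by
          simp only [lk, Finset.mem_filter, Finset.insert_erase hxF]
          exact ⟨hC.2 F hF _ (Finset.erase_subset x F), Finset.notMem_erase x F, hF⟩
        have hle := ihlk.1 _ hmem
        have hsum : ∑ i, a' i < ∑ i, a i := Fintype.sum_strictMono hlt
        have := Finset.card_erase_add_one hxF
        omega
      · exact ihdl.1 F (Finset.mem_filter.mpr ⟨hF, hxF⟩)
    · obtain ⟨F, hF, hcard⟩ := ihdl.2
      exact ⟨F, (Finset.mem_filter.mp hF).1, hcard⟩
end

section
/- Let a = (a_1,…,a_n) ∈ ℙ^n, let (Δ, π) be a pure color-shifted balanced complex of type a, with π = (V_1,…,V_n) the corresponding ordered partition of its vertex set. If Δ is not an a-rib of a simplex, then for every i ∈ [n] with |V_i| > a_i, the maximal element of V_i (with respect to the fixed linear order on V_i) is a Macaulay shedding vertex of Δ. -/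
open Finset

/-- `(Δ, V)` is a colored complex of type `a`. -/
def IsColoredComplex {α : Type*} [DecidableEq α] {n : ℕ} (a : Fin n → ℕ)
    (Δ : Finset (Finset α)) (V : Fin n → Finset α) : Prop :=
  IsSimplicialComplex Δ ∧ IsOrderedPartition V (vertexSet Δ) ∧
    ∀ F ∈ Δ, ∀ i, (F ∩ V i).card ≤ a i

/-- `(Δ, V)` is a balanced complex of type `a`: an `a`-colored complex of
dimension `|a| - 1`. -/
def IsBalancedComplex {α : Type*} [DecidableEq α] {n : ℕ} (a : Fin n → ℕ)
    (Δ : Finset (Finset α)) (V : Fin n → Finset α) : Prop :=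
  IsColoredComplex a Δ V ∧ (∀ F ∈ Δ, F.card ≤ ∑ i, a i) ∧ ∃ F ∈ Δ, F.card = ∑ i, a i

/-- `(Δ, V)` is color-shifted (with respect to the linear order on the vertices). -/
def IsColorShifted {α : Type*} [LinearOrder α] {n : ℕ} (Δ : Finset (Finset α))
    (V : Fin n → Finset α) : Prop :=
  ∀ F ∈ Δ, ∀ i : Fin n, ∀ v ∈ V i, ∀ v' ∈ V i,
    v' < v → v ∈ F → v' ∉ F → insert v' (F.erase v) ∈ Δ

/-- `Δ` is pure: all facets have the same dimension. -/
def IsPureComplex {α : Type*} (Δ : Finset (Finset α)) : Prop :=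
  ∀ F G, IsFacet Δ F → IsFacet Δ G → F.card = G.card

/-- A color-shifted complex on disjoint nonempty color classes `V`, all of whose facets have
exactly `a i` vertices of color `i`.  Unlike in `IsBalancedComplex`, the entries of `a` may vanish
and `V` may contain elements that are not vertices of `Δ`; this makes the notion stable under
deletions and links of maximal vertices. -/
structure IsShiftedOfType {α : Type*} [LinearOrder α] {n : ℕ} (a : Fin n → ℕ)
    (Δ : Finset (Finset α)) (V : Fin n → Finset α) : Prop where
  isComplex : IsSimplicialComplex Δ
  nonempty : ∀ i, (V i).Nonempty
  disjoint : ∀ i j, i ≠ j → Disjoint (V i) (V j)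
  subset : ∀ F ∈ Δ, F ⊆ Finset.univ.biUnion V
  exists_superset : ∀ F ∈ Δ, ∃ G ∈ Δ, F ⊆ G ∧ ∀ i, (G ∩ V i).card = a i
  shifted : IsColorShifted Δ V

namespace IsShiftedOfType

variable {α : Type*} [LinearOrder α] {n : ℕ} {a : Fin n → ℕ} {Δ : Finset (Finset α)}
  {V : Fin n → Finset α} {i : Fin n} {x : α}

theorem notMem_of_ne (h : IsShiftedOfType a Δ V) (hx : x ∈ V i) {j : Fin n} (hj : j ≠ i) :
    x ∉ V j :=
  fun hxj => Finset.disjoint_left.1 (h.disjoint j i hj) hxj hx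

theorem erase_nonempty (h : IsShiftedOfType a Δ V) (hx : x ∈ V i) (hpos : 0 < a i)
    (hlt : a i < (V i).card) (j : Fin n) : ((V j).erase x).Nonempty := by
  by_cases hj : j = i
  · subst hj
    rw [← card_pos, card_erase_of_mem hx]
    omega
  · rw [erase_eq_of_notMem (h.notMem_of_ne hx hj)]
    exact h.nonempty j

theorem disjoint_erase (h : IsShiftedOfType a Δ V) (j k : Fin n) (hjk : j ≠ k) :
    Disjoint ((V j).erase x) ((V k).erase x) :=
  (h.disjoint j k hjk).mono (erase_subset _ _) (erase_subset _ _)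

theorem subset_erase (h : IsShiftedOfType a Δ V) {F : Finset α} (hF : F ∈ Δ) (hxF : x ∉ F) :
    F ⊆ Finset.univ.biUnion fun j => (V j).erase x := by
  intro y hy
  obtain ⟨j, hj, hyj⟩ := mem_biUnion.1 (h.subset F hF hy)
  exact mem_biUnion.2 ⟨j, hj, mem_erase.2 ⟨fun e => hxF (e ▸ hy), hyj⟩⟩

theorem inter_erase_of_notMem {F S : Finset α} (hxF : x ∉ F) : F ∩ S.erase x = F ∩ S := by
  rw [inter_erase, erase_eq_of_notMem fun hx => hxF (mem_inter.1 hx).1]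

theorem del_max (h : IsShiftedOfType a Δ V) (hx : x ∈ V i) (hmax : ∀ y ∈ V i, y ≤ x)
    (hpos : 0 < a i) (hlt : a i < (V i).card) :
    IsShiftedOfType a (del Δ x) fun j => (V j).erase x where
  isComplex := by
    obtain ⟨⟨F, hF⟩, hdown⟩ := h.isComplex
    refine ⟨⟨∅, mem_filter.2 ⟨hdown F hF ∅ (empty_subset F), notMem_empty x⟩⟩, ?_⟩
    intro G hG K hK
    obtain ⟨hG, hxG⟩ := mem_filter.1 hG
    exact mem_filter.2 ⟨hdown G hG K hK, fun hxK => hxG (hK hxK)⟩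
  nonempty := h.erase_nonempty hx hpos hlt
  disjoint := h.disjoint_erase
  subset := fun F hF => h.subset_erase (mem_filter.1 hF).1 (mem_filter.1 hF).2
  exists_superset := by
    intro F hF
    obtain ⟨hF, hxF⟩ := mem_filter.1 hF
    obtain ⟨G, hG, hFG, hcard⟩ := h.exists_superset F hF
    by_cases hxG : x ∈ G
    · obtain ⟨v, hv, hvG⟩ : ∃ v ∈ V i, v ∉ G := by
        by_contra! hsub
        have := card_le_card (subset_inter (fun v hv => hsub v hv) (Subset.refl (V i)))
        have := hcard i
        omega
      have hvx : v ≠ x := fun e => hvG (e ▸ hxG)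
      have hxnew : x ∉ insert v (G.erase x) := by simp [hvx.symm]
      refine ⟨insert v (G.erase x), mem_filter.2
        ⟨h.shifted G hG i x hx v hv ((hmax v hv).lt_of_ne hvx) hxG hvG, hxnew⟩,
        fun y hy => mem_insert_of_mem (mem_erase.2 ⟨fun e => hxF (e ▸ hy), hFG hy⟩), ?_⟩
      intro j
      rw [inter_erase_of_notMem hxnew]
      by_cases hj : j = i
      · subst hj
        rw [insert_inter_of_mem hv, card_insert_of_notMem (by simp [hvG]), erase_inter,
          card_erase_of_mem (mem_inter.2 ⟨hxG, hx⟩), hcard]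
        omega
      · rw [insert_inter_of_notMem (h.notMem_of_ne hv hj), erase_inter,
          erase_eq_of_notMem (by simp [h.notMem_of_ne hx hj]), hcard]
    · exact ⟨G, mem_filter.2 ⟨hG, hxG⟩, hFG, fun j => by
        rw [inter_erase_of_notMem hxG, hcard]⟩
  shifted := by
    intro F hF j v hv v' hv' hlt' hvF hvF'
    obtain ⟨hF, hxF⟩ := mem_filter.1 hF
    refine mem_filter.2 ⟨h.shifted F hF j v (mem_of_mem_erase hv) v' (mem_of_mem_erase hv')
      hlt' hvF hvF', ?_⟩
    simp [(ne_of_mem_erase hv').symm, hxF]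

theorem lk_max (h : IsShiftedOfType a Δ V) (hx : x ∈ V i) (hxΔ : {x} ∈ Δ)
    (hpos : 0 < a i) (hlt : a i < (V i).card) :
    IsShiftedOfType (Function.update a i (a i - 1)) (lk Δ x) fun j => (V j).erase x where
  isComplex := by
    have hdown := h.isComplex.2
    refine ⟨⟨∅, mem_filter.2 ⟨hdown _ hxΔ ∅ (empty_subset _), notMem_empty x, hxΔ⟩⟩, ?_⟩
    intro G hG K hK
    obtain ⟨hG, hxG, hGx⟩ := mem_filter.1 hG
    exact mem_filter.2 ⟨hdown G hG K hK, fun hxK => hxG (hK hxK),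
      hdown _ hGx _ (insert_subset_insert x hK)⟩
  nonempty := h.erase_nonempty hx hpos hlt
  disjoint := h.disjoint_erase
  subset := fun F hF => h.subset_erase (mem_filter.1 hF).1 (mem_filter.1 hF).2.1
  exists_superset := by
    intro F hF
    obtain ⟨hF, hxF, hFx⟩ := mem_filter.1 hF
    obtain ⟨G, hG, hFG, hcard⟩ := h.exists_superset _ hFx
    have hxG : x ∈ G := hFG (mem_insert_self x F)
    refine ⟨G.erase x, mem_filter.2 ⟨h.isComplex.2 G hG _ (erase_subset x G),
      notMem_erase x G, by rwa [insert_erase hxG]⟩,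
      fun y hy => mem_erase.2 ⟨fun e => hxF (e ▸ hy), hFG (mem_insert_of_mem hy)⟩, ?_⟩
    intro j
    rw [inter_erase_of_notMem (notMem_erase x G), erase_inter]
    by_cases hj : j = i
    · subst hj
      rw [card_erase_of_mem (mem_inter.2 ⟨hxG, hx⟩), hcard, Function.update_self]
    · rw [erase_eq_of_notMem (by simp [h.notMem_of_ne hx hj]), hcard,
        Function.update_of_ne hj]
  shifted := by
    intro F hF j v hv v' hv' hlt' hvF hvF'
    obtain ⟨hF, hxF, hFx⟩ := mem_filter.1 hF
    have hv'x := ne_of_mem_erase hv'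
    refine mem_filter.2 ⟨h.shifted F hF j v (mem_of_mem_erase hv) v' (mem_of_mem_erase hv')
      hlt' hvF hvF', by simp [hv'x.symm, hxF], ?_⟩
    have := h.shifted _ hFx j v (mem_of_mem_erase hv) v' (mem_of_mem_erase hv')
      hlt' (mem_insert_of_mem hvF) (by simp [hv'x, hvF'])
    rwa [erase_insert_of_ne (ne_of_mem_erase hv).symm, insert_comm] at this

theorem not_isFacet_del (h : IsShiftedOfType a Δ V) (hx : x ∈ V i)
    (hmax : ∀ y ∈ V i, y ≤ x) (hxΔ : {x} ∈ Δ) (hpos : 0 < a i) (hlt : a i < (V i).card)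
    (F : Finset α) (hF : IsFacet (lk Δ x) F) : ¬ IsFacet (del Δ x) F := by
  intro hF'
  obtain ⟨G, hG, hFG, hGcard⟩ := (h.lk_max hx hxΔ hpos hlt).exists_superset F hF.1
  obtain ⟨H, hH, hFH, hHcard⟩ := (h.del_max hx hmax hpos hlt).exists_superset F hF'.1
  have hGi := hGcard i
  have hHi := hHcard i
  rw [hF.2 G hG hFG, Function.update_self] at hGi
  rw [hF'.2 H hH hFH] at hHi
  omega

theorem sum_card_erase_lt (hx : x ∈ V i) :
    ∑ j, ((V j).erase x).card < ∑ j, (V j).card :=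
  sum_lt_sum (fun j _ => card_le_card (erase_subset x (V j)))
    ⟨i, mem_univ i, card_erase_lt_of_mem hx⟩

/-- A maximal element of a color class that is not a vertex of the complex may be discarded. -/
theorem erase_of_singleton_notMem (h : IsShiftedOfType a Δ V) (hx : x ∈ V i)
    (hxΔ : {x} ∉ Δ) (hpos : 0 < a i) (hlt : a i < (V i).card) :
    IsShiftedOfType a Δ fun j => (V j).erase x := by
  have hxF : ∀ F ∈ Δ, x ∉ F := fun F hF hxF =>
    hxΔ (h.isComplex.2 F hF _ (singleton_subset_iff.2 hxF))
  refine ⟨h.isComplex, h.erase_nonempty hx hpos hlt, h.disjoint_erase,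
    fun F hF => h.subset_erase hF (hxF F hF), fun F hF => ?_,
    fun F hF j v hv v' hv' => h.shifted F hF j v (mem_of_mem_erase hv) v' (mem_of_mem_erase hv')⟩
  obtain ⟨G, hG, hFG, hcard⟩ := h.exists_superset F hF
  exact ⟨G, hG, hFG, fun j => by rw [inter_erase_of_notMem (hxF G hG), hcard]⟩

theorem isRibOfSimplex (h : IsShiftedOfType a Δ V) (hn : 0 < n)
    (hfull : ∀ i, 0 < a i → (V i).card ≤ a i) : IsRibOfSimplex a Δ := by
  have hVsub : ∀ j, V j ⊆ Finset.univ.biUnion V := fun j =>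
    subset_biUnion_of_mem V (mem_univ j)
  have huniq : ∀ F ⊆ Finset.univ.biUnion V, ∀ G, (∀ i, (F ∩ V i).card = a i) →
      (∀ i, (G ∩ V i).card = a i) → F ⊆ G := by
    intro F hF G hFc hGc y hy
    obtain ⟨j, -, hyj⟩ := mem_biUnion.1 (hF hy)
    have hpos : 0 < a j := hFc j ▸ card_pos.2 ⟨y, mem_inter.2 ⟨hy, hyj⟩⟩
    have hG : G ∩ V j = V j := eq_of_subset_of_card_le inter_subset_right
      ((hfull j hpos).trans_eq (hGc j).symm)
    exact (mem_inter.1 (hG.symm ▸ hyj : y ∈ G ∩ V j)).1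
  have hvert : vertexSet (Finset.univ.biUnion V).powerset = Finset.univ.biUnion V :=
    le_antisymm (Finset.sup_le fun F hF => mem_powerset.1 hF)
      (le_sup (f := id) (mem_powerset_self _))
  obtain ⟨E, hE⟩ := h.isComplex.1
  obtain ⟨G, hG, -, hGc⟩ := h.exists_superset E hE
  have hGmem : G ∈ (Finset.univ.biUnion V).powerset.filter
      fun F => ∀ i, (F ∩ V i).card = a i :=
    mem_filter.2 ⟨mem_powerset.2 (h.subset G hG), hGc⟩
  refine ⟨Finset.univ.biUnion V, (h.nonempty ⟨0, hn⟩).mono (hVsub _), V,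
    ⟨h.nonempty, h.disjoint, hvert.symm⟩, ⟨G, hGmem⟩, ?_⟩
  ext K
  simp only [generatedComplex, mem_insert, mem_biUnion, mem_powerset]
  constructor
  · intro hK
    obtain ⟨H, hH, hKH, hHc⟩ := h.exists_superset K hK
    exact Or.inr ⟨H, mem_filter.2 ⟨mem_powerset.2 (h.subset H hH), hHc⟩, hKH⟩
  · rintro (rfl | ⟨H, hH, hKH⟩)
    · exact h.isComplex.2 G hG _ (empty_subset G)
    · obtain ⟨hH, hHc⟩ := mem_filter.1 hH
      exact h.isComplex.2 G hG K (hKH.trans (huniq H (mem_powerset.1 hH) G hHc hGc))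

theorem macaulayDecomposable (hn : 0 < n) (h : IsShiftedOfType a Δ V) :
    MacaulayDecomposable a Δ := by
  induction hm : ∑ j, (V j).card using Nat.strong_induction_on generalizing a Δ V with
  | _ m ih =>
    subst hm
    by_cases hfull : ∀ i, 0 < a i → (V i).card ≤ a i
    · exact .rib a Δ (h.isRibOfSimplex hn hfull)
    · push Not at hfull
      obtain ⟨i, hpos, hlt⟩ := hfull
      have hx := (V i).max'_mem (h.nonempty i)
      have hmax := (V i).le_max'
      set x := (V i).max' (h.nonempty i)
      by_cases hxΔ : {x} ∈ Δ
      · exact .shed a (Function.update a i (a i - 1)) Δ x h.isComplex hxΔ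
          (update_lt_self_iff.2 (by omega))
          (ih _ (sum_card_erase_lt hx) (h.del_max hx hmax hpos hlt) rfl)
          (ih _ (sum_card_erase_lt hx) (h.lk_max hx hxΔ hpos hlt) rfl)
          (h.not_isFacet_del hx hmax hxΔ hpos hlt)
      · exact ih _ (sum_card_erase_lt hx) (h.erase_of_singleton_notMem hx hxΔ hpos hlt) rfl

theorem isMacaulaySheddingVertex (hn : 0 < n) (h : IsShiftedOfType a Δ V) (hx : x ∈ V i)
    (hmax : ∀ y ∈ V i, y ≤ x) (hxΔ : {x} ∈ Δ) (hpos : 0 < a i) (hlt : a i < (V i).card) :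
    IsMacaulaySheddingVertex a Δ x :=
  ⟨hxΔ, Function.update a i (a i - 1), update_lt_self_iff.2 (by omega),
    (h.del_max hx hmax hpos hlt).macaulayDecomposable hn,
    (h.lk_max hx hxΔ hpos hlt).macaulayDecomposable hn,
    h.not_isFacet_del hx hmax hxΔ hpos hlt⟩

end IsShiftedOfType

theorem subset_vertexSet {α : Type*} [DecidableEq α] {Δ : Finset (Finset α)} {F : Finset α}
    (hF : F ∈ Δ) : F ⊆ vertexSet Δ :=
  le_sup (f := id) hF

theorem IsSimplicialComplex.singleton_mem {α : Type*} [DecidableEq α]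
    {Δ : Finset (Finset α)} (hΔ : IsSimplicialComplex Δ) {x : α} (hx : x ∈ vertexSet Δ) :
    {x} ∈ Δ := by
  obtain ⟨F, hF, hxF⟩ := mem_sup.1 hx
  exact hΔ.2 F hF _ (singleton_subset_iff.2 hxF)

theorem IsBalancedComplex.isShiftedOfType {α : Type*} [LinearOrder α] {n : ℕ}
    {a : Fin n → ℕ} {Δ : Finset (Finset α)} {V : Fin n → Finset α}
    (hbal : IsBalancedComplex a Δ V) (hpure : IsPureComplex Δ) (hcs : IsColorShifted Δ V) :
    IsShiftedOfType a Δ V := by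
  obtain ⟨⟨hC, ⟨hne, hdisj, hcover⟩, hcol⟩, hle, T, hT, hTcard⟩ := hbal
  have hsub : ∀ F ∈ Δ, F ⊆ Finset.univ.biUnion V := fun F hF =>
    hcover.symm ▸ subset_vertexSet hF
  refine ⟨hC, hne, hdisj, hsub, fun F hF => ?_, hcs⟩
  obtain ⟨G, hG, hFG⟩ := exists_isFacet_superset hF
  have hTfacet : IsFacet Δ T :=
    ⟨hT, fun K hK hTK => (eq_of_subset_of_card_le hTK (hTcard ▸ hle K hK)).symm⟩
  have hsum : ∑ i, (G ∩ V i).card = ∑ i, a i := by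
    rw [← hTcard, hpure T G hTfacet hG, ← card_biUnion fun i _ j _ hij =>
      (hdisj i j hij).mono inter_subset_right inter_subset_right, ← inter_biUnion,
      inter_eq_left.2 (hsub G hG.1)]
  exact ⟨G, hG.1, hFG, fun i =>
    (sum_eq_sum_iff_of_le fun i _ => hcol G hG.1 i).1 hsum i (mem_univ i)⟩

/-- If a pure color-shifted balanced complex `(Δ, V)` of type
`a` is not an `a`-rib of a simplex, then for every color `i` with `|V i| > a i`,
the maximal vertex of `V i` is a Macaulay shedding vertex of `Δ`. -/
theorem maxVertex_isMacaulaySheddingVertex {α : Type*} [LinearOrder α] {n : ℕ}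
    (hn : 0 < n) (a : Fin n → ℕ) (ha : ∀ i, 0 < a i)
    (Δ : Finset (Finset α)) (V : Fin n → Finset α)
    (hbal : IsBalancedComplex a Δ V) (hpure : IsPureComplex Δ)
    (hcs : IsColorShifted Δ V) (hnr : ¬ IsRibOfSimplex a Δ) :
    ∀ i : Fin n, a i < (V i).card → ∀ x ∈ V i, (∀ y ∈ V i, y ≤ x) →
      IsMacaulaySheddingVertex a Δ x := by
  intro i hlt x hx hmax
  have hxv : x ∈ vertexSet Δ :=
    hbal.1.2.1.2.2 ▸ mem_biUnion.2 ⟨i, mem_univ i, hx⟩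
  exact (hbal.isShiftedOfType hpure hcs).isMacaulaySheddingVertex hn hx hmax
    (hbal.1.1.singleton_mem hxv) (ha i) hlt
end
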